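/- arXiv:1802.10178 — 9 statements merged into one kernel-verified Lean document; each statement's English description precedes it below -/
import Mathlib

section
/- Let Z = m_1P_1 + ⋯ + m_nP_n be a fat point scheme supported at distinct collinear points P_1,…,P_n of P^N with nonnegative integer multiplicities m_i. Then I(Z)^{(m)} = I(Z)^m for all m ∈ ℕ, i.e. (⋂_{i=1}^n I(P_i)^{m_i})^m = ⋂_{i=1}^n I(P_i)^{m·m_i} for every m ≥ 0; consequently, if some m_i ≥ 1 (so that I(Z) is a nonzero proper ideal), ρ(I(Z)) = 1. -/
/-- The ideal of the point `[-d : c : 0 : ⋯ : 0]` on the line `x_2 = ⋯ = x_N = 0`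
in `P^N`, namely `(c·x_0 + d·x_1, x_2, …, x_N)`. -/
noncomputable def linePtIdeal (K : Type*) [Field K] (N : ℕ) (c d : K) :
    Ideal (MvPolynomial (Fin (N + 1)) K) :=
  Ideal.span ({MvPolynomial.C c * MvPolynomial.X 0 + MvPolynomial.C d * MvPolynomial.X 1} ∪
    {f | ∃ i : Fin (N + 1), 2 ≤ (i : ℕ) ∧ f = MvPolynomial.X i})

/-- The resurgence `ρ(I) = sup { m/r : I^{(m)} ⊄ I^r }` of an ideal `I` whose
`m`-th symbolic power is `symb m`. -/
noncomputable def resurgence {R : Type*} [CommRing R] (I : Ideal R) (symb : ℕ → Ideal R) : ℝ :=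
  sSup {x : ℝ | ∃ m r : ℕ, 0 < m ∧ 0 < r ∧ ¬ symb m ≤ I ^ r ∧ x = (m : ℝ) / (r : ℝ)}

theorem Nat.mul_sub_mul_add_eq_of_lt {m r q u : ℕ} (hr : r < m) :
    m * u - (m * q + r) = (u - q) * (m - r) + (u - (q + 1)) * r := by
  rcases le_or_gt u q with h | h
  · have := Nat.mul_le_mul_left m h
    rw [Nat.sub_eq_zero_of_le h, Nat.sub_eq_zero_of_le (by omega : u ≤ q + 1)]
    omega
  · obtain ⟨k, rfl⟩ := Nat.exists_eq_add_of_lt h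
    obtain ⟨l, rfl⟩ := Nat.exists_eq_add_of_lt hr
    rw [show q + k + 1 - q = k + 1 by omega, show q + k + 1 - (q + 1) = k by omega,
      show r + l + 1 - r = l + 1 by omega, Nat.sub_eq_iff_eq_add (by nlinarith)]
    ring

namespace MvPolynomial

section CommRing

variable {σ S : Type*} [CommRing S]

/-- The ideal of polynomials whose coefficients in degree `t` are divisible by `g t`. -/
def coeffDvdIdeal (σ : Type*) {S : Type*} [CommRing S] (g : ℕ → S)
    (hg : ∀ s t, s ≤ t → g t ∣ g s) : Ideal (MvPolynomial σ S) where
  carrier := {f | ∀ α : σ →₀ ℕ, g α.degree ∣ f.coeff α}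
  add_mem' := fun hf hf' α => by
    rw [coeff_add]
    exact dvd_add (hf α) (hf' α)
  zero_mem' := fun α => by simp
  smul_mem' := fun p f hf α => by
    classical
    rw [smul_eq_mul, coeff_mul]
    refine Finset.dvd_sum fun x hx => Dvd.dvd.mul_left ((hg _ _ ?_).trans (hf x.2)) _
    rw [← Finset.HasAntidiagonal.mem_antidiagonal.1 hx, map_add]
    exact Nat.le_add_left _ _

theorem span_C_sup_idealOfVars_le (F : S) :
    Ideal.span {C F} ⊔ idealOfVars σ S ≤
      coeffDvdIdeal σ (fun t => F ^ (1 - t)) fun _ _ h => pow_dvd_pow F (by omega) := by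
  classical
  refine sup_le ?_ ?_
  · rw [Ideal.span_singleton_le_iff_mem]
    intro α
    rw [coeff_C]
    split_ifs with h
    · exact (pow_dvd_pow F (Nat.sub_le 1 _)).trans (by simp)
    · exact dvd_zero _
  · rw [idealOfVars, Ideal.span_le]
    rintro _ ⟨i, rfl⟩ α
    rw [coeff_X]
    split_ifs with h
    · simp [← h]
    · exact dvd_zero _

theorem pow_sub_degree_dvd_coeff (F : S) (a : ℕ) {f : MvPolynomial σ S}
    (hf : f ∈ (Ideal.span {C F} ⊔ idealOfVars σ S) ^ a) (α : σ →₀ ℕ) :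
    F ^ (a - α.degree) ∣ f.coeff α := by
  classical
  suffices h : (Ideal.span {C F} ⊔ idealOfVars σ S) ^ a ≤
      coeffDvdIdeal σ (fun t => F ^ (a - t)) fun _ _ h => pow_dvd_pow F (by omega) from h hf α
  clear hf α f
  induction a with
  | zero => intro f _ α; simp
  | succ a ih =>
    rw [pow_succ, Ideal.mul_le]
    intro p hp q hq α
    rw [coeff_mul]
    refine Finset.dvd_sum fun x hx => ?_
    have h := mul_dvd_mul (ih hp x.1) (span_C_sup_idealOfVars_le F hq x.2)
    dsimp only at h
    rw [← pow_add] at h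
    refine (pow_dvd_pow F ?_).trans h
    rw [← Finset.HasAntidiagonal.mem_antidiagonal.1 hx, map_add]
    omega

theorem span_C_prod_mul_idealOfVars_pow_le {ι : Type*} [Fintype ι] (F : ι → S) (μ : ι → ℕ)
    (s : ℕ) :
    Ideal.span {C (∏ i, F i ^ (μ i - s))} * idealOfVars σ S ^ s ≤
      ⨅ i, (Ideal.span {C (F i)} ⊔ idealOfVars σ S) ^ μ i := by
  refine le_iInf fun i => ?_
  calc Ideal.span {C (∏ i, F i ^ (μ i - s))} * idealOfVars σ S ^ s
      ≤ Ideal.span {C (F i)} ^ (μ i - s) * idealOfVars σ S ^ s := by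
        refine Ideal.mul_mono_left ?_
        rw [Ideal.span_singleton_pow, Ideal.span_singleton_le_span_singleton, ← C_pow]
        exact map_dvd C (Finset.dvd_prod_of_mem _ (Finset.mem_univ i))
    _ ≤ (Ideal.span {C (F i)} ⊔ idealOfVars σ S) ^ (μ i - s) *
          (Ideal.span {C (F i)} ⊔ idealOfVars σ S) ^ s :=
        Ideal.mul_mono (Ideal.pow_right_mono le_sup_left _) (Ideal.pow_right_mono le_sup_right _)
    _ ≤ (Ideal.span {C (F i)} ⊔ idealOfVars σ S) ^ μ i := by
        rw [← pow_add]
        exact Ideal.pow_le_pow_right (by omega)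

/-- Splitting a degree `t` evenly into `m` parts distributes the exponents `m * μ i - t`. -/
theorem span_C_prod_mul_idealOfVars_pow_le_pow {ι : Type*} [Fintype ι] (F : ι → S) (μ : ι → ℕ)
    {m : ℕ} (hm : 0 < m) (t : ℕ) :
    Ideal.span {C (∏ i, F i ^ (m * μ i - t))} * idealOfVars σ S ^ t ≤
      (⨅ i, (Ideal.span {C (F i)} ⊔ idealOfVars σ S) ^ μ i) ^ m := by
  obtain ⟨q, r, hr, rfl⟩ : ∃ q r, r < m ∧ t = m * q + r :=
    ⟨t / m, t % m, Nat.mod_lt _ hm, (Nat.div_add_mod t m).symm⟩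
  have hprod : ∏ i, F i ^ (m * μ i - (m * q + r)) =
      (∏ i, F i ^ (μ i - q)) ^ (m - r) * (∏ i, F i ^ (μ i - (q + 1))) ^ r := by
    rw [← Finset.prod_pow, ← Finset.prod_pow, ← Finset.prod_mul_distrib]
    refine Finset.prod_congr rfl fun i _ => ?_
    rw [Nat.mul_sub_mul_add_eq_of_lt hr, pow_add, pow_mul, pow_mul]
  have hdeg : m * q + r = q * (m - r) + (q + 1) * r := by
    obtain ⟨l, rfl⟩ := Nat.exists_eq_add_of_lt hr
    rw [show r + l + 1 - r = l + 1 by omega]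
    ring
  calc Ideal.span {C (∏ i, F i ^ (m * μ i - (m * q + r)))} * idealOfVars σ S ^ (m * q + r)
      = (Ideal.span {C (∏ i, F i ^ (μ i - q))} * idealOfVars σ S ^ q) ^ (m - r) *
        (Ideal.span {C (∏ i, F i ^ (μ i - (q + 1)))} * idealOfVars σ S ^ (q + 1)) ^ r := by
        rw [hprod, hdeg, map_mul, map_pow, map_pow, ← Ideal.span_singleton_mul_span_singleton,
          ← Ideal.span_singleton_pow, ← Ideal.span_singleton_pow, pow_add (idealOfVars σ S),
          pow_mul, pow_mul]
        ring
    _ ≤ _ := Ideal.mul_mono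
        (Ideal.pow_right_mono (span_C_prod_mul_idealOfVars_pow_le F μ q) _)
        (Ideal.pow_right_mono (span_C_prod_mul_idealOfVars_pow_le F μ (q + 1)) _)
    _ = _ := by rw [← pow_add, Nat.sub_add_cancel hr.le]

theorem iInf_pow_pow_eq_iInf_pow_mul [DecompositionMonoid S] {ι : Type*} [Fintype ι]
    (F : ι → S) (hF : Pairwise fun i j => IsRelPrime (F i) (F j)) (μ : ι → ℕ) (m : ℕ) :
    (⨅ i, (Ideal.span {C (F i)} ⊔ idealOfVars σ S) ^ μ i) ^ m =
      ⨅ i, (Ideal.span {C (F i)} ⊔ idealOfVars σ S) ^ (m * μ i) := by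
  rcases Nat.eq_zero_or_pos m with rfl | hm
  · simp
  refine le_antisymm (le_iInf fun i => ?_) fun f hf => ?_
  · rw [mul_comm, pow_mul]
    exact Ideal.pow_right_mono (iInf_le _ i) m
  · rw [← support_sum_monomial_coeff f]
    refine Ideal.sum_mem _ fun α _ => ?_
    refine span_C_prod_mul_idealOfVars_pow_le_pow F μ hm α.degree ?_
    rw [← mul_one (coeff α f), ← C_mul_monomial]
    refine Ideal.mul_mem_mul (Ideal.mem_span_singleton.2 (map_dvd C ?_)) ?_
    · refine Finset.prod_dvd_of_isRelPrime (fun i _ j _ hij => (hF hij).pow) fun i _ => ?_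
      exact pow_sub_degree_dvd_coeff (F i) _ (Ideal.mem_iInf.1 hf i) α
    · refine (mem_pow_idealOfVars_iff' _ _).2 fun x hx => ?_
      classical
      rw [coeff_monomial, if_neg]
      rintro rfl
      exact hx.false

end CommRing

theorem isRelPrime_linearForms {τ K : Type*} [Field K] {a b : τ} (hab : a ≠ b) {c d c' d' : K}
    (h : c * d' - c' * d ≠ 0) :
    IsRelPrime (C c * X a + C d * X b : MvPolynomial τ K) (C c' * X a + C d' * X b) := by
  intro p hp hp'
  have hu : IsUnit (C (c * d' - c' * d) : MvPolynomial τ K) := (isUnit_iff_ne_zero.2 h).map C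
  have ha : p ∣ X a := by
    rw [← hu.dvd_mul_left]
    have := dvd_sub (hp.mul_left (C d')) (hp'.mul_left (C d))
    convert this using 1
    simp only [map_sub, map_mul]
    ring
  have hb : p ∣ X b := by
    rw [← hu.dvd_mul_left]
    have := dvd_sub (hp'.mul_left (C c)) (hp.mul_left (C c'))
    convert this using 1
    simp only [map_sub, map_mul]
    ring
  rcases (X_prime (i := a) (R := K)).irreducible.dvd_iff.1 ha with h1 | h1
  · exact h1
  · exact absurd (X_dvd_X.1 (h1.dvd.trans hb)) hab

end MvPolynomial

open MvPolynomial in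
theorem exists_ringEquiv_map_linePtIdeal (K : Type*) [Field K] (N : ℕ) (hN : 1 ≤ N) :
    ∃ (σ τ : Type) (a b : τ) (_ : a ≠ b)
      (e : MvPolynomial (Fin (N + 1)) K ≃+* MvPolynomial σ (MvPolynomial τ K)),
      ∀ c d : K, (linePtIdeal K N c d).map e =
        Ideal.span {C (C c * X a + C d * X b)} ⊔ idealOfVars σ (MvPolynomial τ K) := by
  have h0 : ¬ 2 ≤ ((0 : Fin (N + 1)) : ℕ) := by simp
  have h1' : ((1 : Fin (N + 1)) : ℕ) = 1 := Nat.mod_eq_of_lt (show 1 < N + 1 by omega)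
  have h1 : ¬ 2 ≤ ((1 : Fin (N + 1)) : ℕ) := by omega
  let p : Fin (N + 1) → Prop := fun i => 2 ≤ (i : ℕ)
  let e : MvPolynomial (Fin (N + 1)) K ≃ₐ[K]
      MvPolynomial {i // p i} (MvPolynomial {i // ¬ p i} K) :=
    (renameEquiv K (Equiv.sumCompl p).symm).trans (sumAlgEquiv K _ _)
  have hX (i : Fin (N + 1)) (hi : p i) : e (X i) = X ⟨i, hi⟩ := by
    simp [e, Equiv.sumCompl_symm_apply_of_pos hi]
  have hX' (i : Fin (N + 1)) (hi : ¬ p i) : e (X i) = C (X ⟨i, hi⟩) := by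
    simp [e, Equiv.sumCompl_symm_apply_of_neg hi]
  have hC (c : K) : e (C c) = C (C c) := by simp [e]
  refine ⟨{i // p i}, {i // ¬ p i}, ⟨0, h0⟩, ⟨1, h1⟩, ?_, e.toRingEquiv, fun c d => ?_⟩
  · intro h
    have := congrArg Fin.val (Subtype.ext_iff.1 h)
    simp at this
    omega
  · rw [linePtIdeal, Ideal.span_union, Ideal.map_sup, Ideal.map_span, Ideal.map_span,
      Set.image_singleton, idealOfVars]
    congr 3
    · change e _ = _
      simp only [map_add, map_mul, hC, hX' 0 h0, hX' 1 h1]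
    · ext f
      constructor
      · rintro ⟨_, ⟨i, hi, rfl⟩, rfl⟩
        exact ⟨⟨i, hi⟩, (hX i hi).symm⟩
      · rintro ⟨⟨i, hi⟩, rfl⟩
        exact ⟨X i, ⟨i, hi, rfl⟩, hX i hi⟩

theorem iInf_linePtIdeal_pow_pow (K : Type*) [Field K] (N n : ℕ) (hN : 1 ≤ N) (c d : Fin n → K)
    (hdist : ∀ i j : Fin n, i ≠ j → c i * d j - c j * d i ≠ 0) (μ : Fin n → ℕ) (m : ℕ) :
    (⨅ i, linePtIdeal K N (c i) (d i) ^ μ i) ^ m =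
      ⨅ i, linePtIdeal K N (c i) (d i) ^ (m * μ i) := by
  obtain ⟨σ, τ, a, b, hab, e, he⟩ := exists_ringEquiv_map_linePtIdeal K N hN
  have hmap (k : Fin n → ℕ) : (⨅ i, linePtIdeal K N (c i) (d i) ^ k i).map e =
      ⨅ i, (linePtIdeal K N (c i) (d i)).map e ^ k i := by
    simp only [← Ideal.map_pow]
    simp only [← RingEquiv.idealComapOrderIso_symm_apply, OrderIso.map_iInf]
  apply e.idealComapOrderIso.symm.injective
  simp only [RingEquiv.idealComapOrderIso_symm_apply]
  rw [Ideal.map_pow, hmap, hmap]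
  simp only [he]
  exact MvPolynomial.iInf_pow_pow_eq_iInf_pow_mul _
    (fun i j hij => MvPolynomial.isRelPrime_linearForms hab (hdist i j hij)) μ m

theorem linePtIdeal_ne_top (K : Type*) [Field K] (N : ℕ) (c d : K) : linePtIdeal K N c d ≠ ⊤ := by
  refine ne_top_of_le_ne_top
    (RingHom.ker_ne_top (MvPolynomial.constantCoeff (σ := Fin (N + 1)) (R := K))) ?_
  rw [linePtIdeal, Ideal.span_le]
  rintro _ (rfl | ⟨i, -, rfl⟩)
  · simp [RingHom.mem_ker]
  · simp [RingHom.mem_ker]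

theorem iInf_linePtIdeal_pow_ne_bot (K : Type*) [Field K] (N n : ℕ) (hN : 2 ≤ N)
    (c d : Fin n → K) (μ : Fin n → ℕ) : ⨅ i, linePtIdeal K N (c i) (d i) ^ μ i ≠ ⊥ := by
  let x : MvPolynomial (Fin (N + 1)) K := MvPolynomial.X ⟨2, by omega⟩
  have hx (i : Fin n) : x ∈ linePtIdeal K N (c i) (d i) :=
    Ideal.subset_span (Or.inr ⟨_, le_rfl, rfl⟩)
  refine (Submodule.ne_bot_iff _).2 ⟨x ^ ∑ i, μ i, Ideal.mem_iInf.2 fun i => ?_,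
    pow_ne_zero _ (MvPolynomial.X_ne_zero _)⟩
  exact Ideal.pow_le_pow_right (Finset.single_le_sum (fun _ _ => Nat.zero_le _)
    (Finset.mem_univ i)) (Ideal.pow_mem_pow (hx i) _)

theorem Ideal.not_pow_le_pow_succ {R : Type*} [CommRing R] [IsDomain R] [IsNoetherianRing R]
    {I : Ideal R} (hbot : I ≠ ⊥) (htop : I ≠ ⊤) {m : ℕ} (hm : m ≠ 0) : ¬ I ^ m ≤ I ^ (m + 1) := by
  intro h
  have hstep : I ^ m = I ^ m * I :=
    (pow_succ I m) ▸ le_antisymm h (Ideal.pow_le_pow_right m.le_succ)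
  have hmul (k : ℕ) : I ^ m * I ^ k = I ^ m := by
    induction k with
    | zero => simp
    | succ k ih => rw [pow_succ, ← mul_assoc, ih, ← hstep]
  rcases (Ideal.isIdempotentElem_iff_eq_bot_or_top (I ^ m) (IsNoetherian.noetherian _)).1 (hmul m)
    with h0 | h1
  · exact pow_ne_zero m hbot h0
  · exact htop (top_le_iff.1 (h1 ▸ Ideal.pow_le_self hm))

theorem resurgence_pow_eq_one {R : Type*} [CommRing R] [IsDomain R] [IsNoetherianRing R]
    {I : Ideal R} (hbot : I ≠ ⊥) (htop : I ≠ ⊤) : resurgence I (fun m => I ^ m) = 1 := by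
  have hub : ∀ x ∈ {x : ℝ | ∃ m r : ℕ, 0 < m ∧ 0 < r ∧ ¬ I ^ m ≤ I ^ r ∧ x = (m : ℝ) / (r : ℝ)},
      x ≤ 1 := by
    rintro _ ⟨m, r, -, hr, h, rfl⟩
    refine div_le_one_of_le₀ ?_ (Nat.cast_nonneg r)
    exact_mod_cast le_of_not_ge fun hle => h (Ideal.pow_le_pow_right hle)
  have hmem (m : ℕ) : ((m + 1 : ℕ) : ℝ) / ((m + 1 + 1 : ℕ) : ℝ) ∈
      {x : ℝ | ∃ m r : ℕ, 0 < m ∧ 0 < r ∧ ¬ I ^ m ≤ I ^ r ∧ x = (m : ℝ) / (r : ℝ)} :=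
    ⟨m + 1, m + 1 + 1, m.succ_pos, (m + 1).succ_pos,
      Ideal.not_pow_le_pow_succ hbot htop m.succ_ne_zero, rfl⟩
  refine le_antisymm (csSup_le ⟨_, hmem 0⟩ hub) ?_
  have h := (tendsto_natCast_div_add_atTop (1 : ℝ)).comp (Filter.tendsto_add_atTop_nat 1)
  refine le_of_tendsto' h fun m => le_csSup ⟨1, hub⟩ ?_
  convert hmem m using 1
  simp

/-- For a fat point scheme `Z = Σ m_i P_i` supported at distinct collinear points of `P^N`,
`I(Z)^{(m)} = I(Z)^m` for all `m`, and hence (if `I(Z)` is nonzero and proper)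
`ρ(I(Z)) = 1`. -/
theorem collinear_fat_points_symbolic_eq_ordinary
    (K : Type*) [Field K] (N n : ℕ) (hN : 2 ≤ N) (hn : 1 ≤ n)
    (c d : Fin n → K)
    (hcd : ∀ i, ¬(c i = 0 ∧ d i = 0))
    (hdist : ∀ i j : Fin n, i ≠ j → c i * d j - c j * d i ≠ 0)
    (μ : Fin n → ℕ) :
    (∀ m : ℕ,
      (⨅ i, linePtIdeal K N (c i) (d i) ^ μ i) ^ m =
        ⨅ i, linePtIdeal K N (c i) (d i) ^ (m * μ i)) ∧
    ((∃ i, 1 ≤ μ i) →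
      resurgence (⨅ i, linePtIdeal K N (c i) (d i) ^ μ i)
        (fun m => ⨅ i, linePtIdeal K N (c i) (d i) ^ (m * μ i)) = 1) := by
  have hpow := iInf_linePtIdeal_pow_pow K N n (by omega) c d hdist μ
  refine ⟨hpow, fun ⟨i, hi⟩ => ?_⟩
  simp only [← hpow]
  refine resurgence_pow_eq_one (iInf_linePtIdeal_pow_ne_bot K N n hN c d μ) ?_
  exact ne_top_of_le_ne_top (linePtIdeal_ne_top K N (c i) (d i))
    ((iInf_le _ i).trans (Ideal.pow_le_self (by omega)))
end

section
/- Let Z = m_0P_0 + m_1P_1 + m_2P_2 be a fat point scheme at three noncollinear points (taken to be the coordinate points) of P^N with m_2 ≥ max(m_0, m_1). Then I(Z)^{(m)} = I(Z)^m for all m ∈ ℕ (equivalently, sdefect(I(Z),m) = 0 for all m) if and only if one of the following holds: (a) m_0 + m_1 ≤ m_2; or (b) m_0 + m_1 > m_2 and m_0 + m_1 + m_2 is even. -/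
/-- The ideal of the `j`-th coordinate point of `P^N`, generated by all
variables `x_i` with `i ≠ j`. -/
noncomputable def ptIdeal (K : Type*) [Field K] (N : ℕ) (j : Fin (N + 1)) :
    Ideal (MvPolynomial (Fin (N + 1)) K) :=
  Ideal.span {f | ∃ i : Fin (N + 1), i ≠ j ∧ f = MvPolynomial.X i}

open MvPolynomial

/-- A function with a prescribed sum below a given function. -/
lemma exists_le_sum_eq {n : ℕ} (t : Fin n → ℕ) (s : ℕ) (hs : s ≤ ∑ i, t i) :
    ∃ u : Fin n → ℕ, u ≤ t ∧ ∑ i, u i = s := by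
  induction s with
  | zero => exact ⟨0, fun i => Nat.zero_le _, by simp⟩
  | succ s ih =>
    obtain ⟨u, hu, hsum⟩ := ih (by omega)
    obtain ⟨i, -, hi⟩ := Finset.exists_lt_of_sum_lt (s := Finset.univ) (f := u) (g := t) (by omega)
    refine ⟨u + Pi.single i 1, fun j => ?_, ?_⟩
    · by_cases hj : j = i
      · subst hj
        simpa using hi
      · simpa [hj] using hu j
    · simp [Finset.sum_add_distrib, hsum]

/-- The monomial ideal generated by the monomials with exponent in `A`. -/
noncomputable def monomialIdeal {σ : Type*} (K : Type*) [Field K] (A : Set (σ →₀ ℕ)) :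
    Ideal (MvPolynomial σ K) :=
  Ideal.span ((fun d => monomial d (1 : K)) '' A)

section MonomialIdeal

variable {σ : Type*} {K : Type*} [Field K]

lemma mem_monomialIdeal_iff_of_isUpperSet {A : Set (σ →₀ ℕ)} (hA : IsUpperSet A)
    (f : MvPolynomial σ K) :
    f ∈ monomialIdeal K A ↔ ∀ d ∈ f.support, d ∈ A := by
  rw [monomialIdeal, mem_ideal_span_monomial_image]
  exact forall₂_congr fun d _ => ⟨fun ⟨e, he, hed⟩ => hA hed he, fun h => ⟨d, h, le_rfl⟩⟩

lemma monomial_mem_monomialIdeal {A : Set (σ →₀ ℕ)} (d : σ →₀ ℕ) :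
    monomial d (1 : K) ∈ monomialIdeal K A ↔ ∃ e ∈ A, e ≤ d := by
  classical
  rw [monomialIdeal, mem_ideal_span_monomial_image]
  simp [support_monomial]

lemma monomialIdeal_mul (A B : Set (σ →₀ ℕ)) :
    monomialIdeal K A * monomialIdeal K B = monomialIdeal K (Set.image2 (· + ·) A B) := by
  rw [monomialIdeal, monomialIdeal, Ideal.span_mul_span', monomialIdeal]
  congr 1
  ext f
  simp only [Set.mem_mul, Set.mem_image, Set.mem_image2]
  constructor
  · rintro ⟨_, ⟨a, ha, rfl⟩, _, ⟨b, hb, rfl⟩, rfl⟩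
    exact ⟨a + b, ⟨a, ha, b, hb, rfl⟩, by simp [monomial_mul]⟩
  · rintro ⟨_, ⟨a, ha, b, hb, rfl⟩, rfl⟩
    exact ⟨_, ⟨a, ha, rfl⟩, _, ⟨b, hb, rfl⟩, by simp [monomial_mul]⟩

end MonomialIdeal

lemma isUpperSet_setOf_add_le_sum {n : ℕ} (j : Fin n) (k : ℕ) :
    IsUpperSet {d : Fin n →₀ ℕ | k + d j ≤ ∑ i, d i} := by
  intro a b hab ha
  simp only [Set.mem_ofPred_eq] at ha ⊢
  rw [← Finset.add_sum_erase _ _ (Finset.mem_univ j)] at ha ⊢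
  have := Finset.sum_le_sum (s := Finset.univ.erase j) fun i _ => hab i
  omega

lemma ptIdeal_pow_eq (K : Type*) [Field K] (N : ℕ) (j : Fin (N + 1)) (k : ℕ) :
    ptIdeal K N j ^ k = monomialIdeal K {d | k + d j ≤ ∑ i, d i} := by
  induction k with
  | zero =>
    symm
    rw [pow_zero, Ideal.one_eq_top, Ideal.eq_top_iff_one, ← C_1, ← monomial_zero',
      monomial_mem_monomialIdeal]
    exact ⟨0, by simp, le_rfl⟩
  | succ k ih =>
    have h1 : ptIdeal K N j =
        monomialIdeal K ((fun i => Finsupp.single i 1) '' {i | i ≠ j}) := by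
      rw [ptIdeal, monomialIdeal]
      congr 1
      ext f
      simp [X, eq_comm]
    rw [pow_succ, ih, h1, monomialIdeal_mul]
    apply le_antisymm
    · rw [monomialIdeal, Ideal.span_le]
      rintro _ ⟨_, ⟨a, ha, _, ⟨i, hi, rfl⟩, rfl⟩, rfl⟩
      refine Ideal.subset_span ⟨_, ?_, rfl⟩
      simp only [Set.mem_ofPred_eq] at ha hi ⊢
      simp only [Finsupp.add_apply, Finset.sum_add_distrib, Finsupp.single_apply, hi,
        Finset.sum_ite_eq, Finset.mem_univ, if_true, if_false]
      omega
    · rw [monomialIdeal, Ideal.span_le]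
      rintro _ ⟨d, hd, rfl⟩
      simp only [Set.mem_ofPred_eq] at hd
      have hd' := hd
      rw [← Finset.add_sum_erase _ _ (Finset.mem_univ j)] at hd'
      obtain ⟨i, hi, hpos⟩ := Finset.exists_ne_zero_of_sum_ne_zero
        (s := Finset.univ.erase j) (f := fun i => d i) (by omega)
      have hij : i ≠ j := (Finset.mem_erase.mp hi).1
      have hsplit : d - Finsupp.single i 1 + Finsupp.single i 1 = d :=
        tsub_add_cancel_of_le (by simpa [Nat.one_le_iff_ne_zero] using hpos)
      refine Ideal.subset_span ⟨d, ⟨d - Finsupp.single i 1, ?_, _, ⟨i, hij, rfl⟩, hsplit⟩, rfl⟩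
      rw [← hsplit] at hd
      simp only [Finsupp.add_apply, Finset.sum_add_distrib, Finsupp.single_apply, hij,
        Finset.sum_ite_eq, Finset.mem_univ, if_true, if_false] at hd
      simp only [Set.mem_ofPred_eq]
      omega

/-- Exponents of the monomials vanishing to orders `k0, k1, k2` at the three points. -/
def fatPointExponents (n k0 k1 k2 : ℕ) : Set (Fin (n + 2 + 1) →₀ ℕ) :=
  {d | k0 + d 0 ≤ ∑ i, d i ∧ k1 + d 1 ≤ ∑ i, d i ∧ k2 + d 2 ≤ ∑ i, d i}

lemma isUpperSet_fatPointExponents (n k0 k1 k2 : ℕ) :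
    IsUpperSet (fatPointExponents n k0 k1 k2) := fun _ _ hab h =>
  ⟨isUpperSet_setOf_add_le_sum 0 k0 hab h.1, isUpperSet_setOf_add_le_sum 1 k1 hab h.2.1,
    isUpperSet_setOf_add_le_sum 2 k2 hab h.2.2⟩

lemma inf_ptIdeal_pow_eq (K : Type*) [Field K] (n k0 k1 k2 : ℕ) :
    ptIdeal K (n + 2) 0 ^ k0 ⊓ ptIdeal K (n + 2) 1 ^ k1 ⊓ ptIdeal K (n + 2) 2 ^ k2 =
      monomialIdeal K (fatPointExponents n k0 k1 k2) := by
  ext f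
  rw [mem_monomialIdeal_iff_of_isUpperSet (isUpperSet_fatPointExponents n k0 k1 k2)]
  simp only [Ideal.mem_inf, ptIdeal_pow_eq,
    mem_monomialIdeal_iff_of_isUpperSet (isUpperSet_setOf_add_le_sum _ _)]
  exact ⟨fun h d hd => ⟨h.1.1 d hd, h.1.2 d hd, h.2 d hd⟩,
    fun h => ⟨⟨fun d hd => (h d hd).1, fun d hd => (h d hd).2.1⟩, fun d hd => (h d hd).2.2⟩⟩

lemma mem_fatPointExponents_iff {n k0 k1 k2 : ℕ} {d : Fin (n + 2 + 1) →₀ ℕ} :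
    d ∈ fatPointExponents n k0 k1 k2 ↔
      k0 ≤ d 1 + d 2 + ∑ i : Fin n, d i.succ.succ.succ ∧
      k1 ≤ d 0 + d 2 + ∑ i : Fin n, d i.succ.succ.succ ∧
      k2 ≤ d 0 + d 1 + ∑ i : Fin n, d i.succ.succ.succ := by
  have h : ∑ i, d i = d 0 + (d 1 + (d 2 + ∑ i : Fin n, d i.succ.succ.succ)) := by
    rw [Fin.sum_univ_succ, Fin.sum_univ_succ, Fin.sum_univ_succ]
    rfl
  rw [fatPointExponents, Set.mem_ofPred_eq, h]
  omega

/-- `(x, y, z, s)` satisfies the vanishing inequalities of orders `k0, k1, k2`, where `s` is the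
total degree in the variables vanishing at all three points. -/
def VanishingIneqs (k0 k1 k2 x y z s : ℕ) : Prop :=
  k0 ≤ y + z + s ∧ k1 ≤ x + z + s ∧ k2 ≤ x + y + s

/-- `(x, y, z, s)` splits into a part of orders `m0, m1, m2` and a part of `M` times these. -/
def Splits4 (m0 m1 m2 M x y z s : ℕ) : Prop :=
  ∃ a b c e a' b' c' e' : ℕ, x = a + a' ∧ y = b + b' ∧ z = c + c' ∧ s = e + e' ∧
    VanishingIneqs m0 m1 m2 a b c e ∧ VanishingIneqs (M * m0) (M * m1) (M * m2) a' b' c' e'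

lemma exists_add_of_le_succ_mul {M l u t : ℕ} (hlu : l ≤ u) (hl : (M + 1) * l ≤ t)
    (hu : t ≤ (M + 1) * u) :
    ∃ a b, t = a + b ∧ l ≤ a ∧ a ≤ u ∧ M * l ≤ b ∧ b ≤ M * u := by
  rw [add_mul, one_mul] at hl hu
  have := Nat.mul_le_mul_left M hlu
  rcases le_total u (t - M * l) with h | h
  · exact ⟨u, t - u, by omega, hlu, le_rfl, by omega, by omega⟩
  · exact ⟨t - M * l, M * l, by omega, by omega, h, le_rfl, this⟩

lemma splits4_of_forall {m0 m1 m2 M : ℕ}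
    (hmin : ∀ x y z s, VanishingIneqs ((M + 1) * m0) ((M + 1) * m1) ((M + 1) * m2) x y z s →
      (x = 0 ∨ x + z + s = (M + 1) * m1 ∨ x + y + s = (M + 1) * m2) →
      (y = 0 ∨ y + z + s = (M + 1) * m0 ∨ x + y + s = (M + 1) * m2) →
      (z = 0 ∨ y + z + s = (M + 1) * m0 ∨ x + z + s = (M + 1) * m1) →
      (s = 0 ∨ (y + z + s = (M + 1) * m0 ∧ x + z + s = (M + 1) * m1 ∧
        x + y + s = (M + 1) * m2)) → Splits4 m0 m1 m2 M x y z s)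
    (k : ℕ) : ∀ x y z s, 2 * (x + y + z) + 3 * s = k →
      VanishingIneqs ((M + 1) * m0) ((M + 1) * m1) ((M + 1) * m2) x y z s →
      Splits4 m0 m1 m2 M x y z s := by
  induction k using Nat.strong_induction_on with
  | _ k ih =>
  intro x y z s hk h
  by_cases hx : x = 0 ∨ x + z + s = (M + 1) * m1 ∨ x + y + s = (M + 1) * m2
  swap
  · obtain ⟨a, b, c, e, a', b', c', e', h1, h2, h3, h4, h5, h6⟩ :=
      ih _ (by omega) (x - 1) y z s rfl (by unfold VanishingIneqs at *; omega)
    refine ⟨a, b, c, e, a' + 1, b', c', e', ?_, h2, h3, h4, h5, ?_⟩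
    · omega
    · unfold VanishingIneqs at *; omega
  by_cases hy : y = 0 ∨ y + z + s = (M + 1) * m0 ∨ x + y + s = (M + 1) * m2
  swap
  · obtain ⟨a, b, c, e, a', b', c', e', h1, h2, h3, h4, h5, h6⟩ :=
      ih _ (by omega) x (y - 1) z s rfl (by unfold VanishingIneqs at *; omega)
    refine ⟨a, b, c, e, a', b' + 1, c', e', h1, ?_, h3, h4, h5, ?_⟩
    · omega
    · unfold VanishingIneqs at *; omega
  by_cases hz : z = 0 ∨ y + z + s = (M + 1) * m0 ∨ x + z + s = (M + 1) * m1
  swap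
  · obtain ⟨a, b, c, e, a', b', c', e', h1, h2, h3, h4, h5, h6⟩ :=
      ih _ (by omega) x y (z - 1) s rfl (by unfold VanishingIneqs at *; omega)
    refine ⟨a, b, c, e, a', b', c' + 1, e', h1, h2, ?_, h4, h5, ?_⟩
    · omega
    · unfold VanishingIneqs at *; omega
  by_cases hs : s = 0 ∨ (y + z + s = (M + 1) * m0 ∧ x + z + s = (M + 1) * m1 ∧
        x + y + s = (M + 1) * m2)
  · exact hmin x y z s h hx hy hz hs
  rw [not_or, not_and_or, not_and_or] at hs
  obtain ⟨hs0, hs | hs | hs⟩ := hs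
  · obtain ⟨a, b, c, e, a', b', c', e', h1, h2, h3, h4, h5, h6⟩ :=
      ih _ (by omega) (x + 1) y z (s - 1) rfl (by unfold VanishingIneqs at *; omega)
    rcases Nat.eq_zero_or_pos a with ha | ha
    · exact ⟨a, b, c, e, a' - 1, b', c', e' + 1, by omega, h2, h3, by omega, h5,
        by unfold VanishingIneqs at *; omega⟩
    · exact ⟨a - 1, b, c, e + 1, a', b', c', e', by omega, h2, h3, by omega,
        by unfold VanishingIneqs at *; omega, h6⟩
  · obtain ⟨a, b, c, e, a', b', c', e', h1, h2, h3, h4, h5, h6⟩ :=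
      ih _ (by omega) x (y + 1) z (s - 1) rfl (by unfold VanishingIneqs at *; omega)
    rcases Nat.eq_zero_or_pos b with hb | hb
    · exact ⟨a, b, c, e, a', b' - 1, c', e' + 1, h1, by omega, h3, by omega, h5,
        by unfold VanishingIneqs at *; omega⟩
    · exact ⟨a, b - 1, c, e + 1, a', b', c', e', h1, by omega, h3, by omega,
        by unfold VanishingIneqs at *; omega, h6⟩
  · obtain ⟨a, b, c, e, a', b', c', e', h1, h2, h3, h4, h5, h6⟩ :=
      ih _ (by omega) x y (z + 1) (s - 1) rfl (by unfold VanishingIneqs at *; omega)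
    rcases Nat.eq_zero_or_pos c with hc | hc
    · exact ⟨a, b, c, e, a', b', c' - 1, e' + 1, h1, h2, by omega, by omega, h5,
        by unfold VanishingIneqs at *; omega⟩
    · exact ⟨a, b, c - 1, e + 1, a', b', c', e', h1, h2, by omega, by omega,
        by unfold VanishingIneqs at *; omega, h6⟩

lemma splits4_of_add_le {m0 m1 m2 M x y z s : ℕ} (hm : m0 + m1 ≤ m2)
    (h : VanishingIneqs ((M + 1) * m0) ((M + 1) * m1) ((M + 1) * m2) x y z s) :
    Splits4 m0 m1 m2 M x y z s := by
  refine splits4_of_forall ?_ _ x y z s rfl h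
  clear h x y z s
  intro x y z s h hx hy hz hs
  obtain ⟨q, rfl⟩ := Nat.exists_eq_add_of_le hm
  simp only [VanishingIneqs, Splits4, mul_add] at *
  have g0 : (M + 1) * m0 = M * m0 + m0 := by ring
  have g1 : (M + 1) * m1 = M * m1 + m1 := by ring
  have g2 : (M + 1) * q = M * q + q := by ring
  have hs0 : s = 0 := by omega
  subst hs0
  by_cases hz0 : z = 0
  · subst hz0
    have key : x + y = (M + 1) * m0 + (M + 1) * m1 + (M + 1) * q := by omega
    obtain ⟨a, b, hab, -, ha, -, hb⟩ := exists_add_of_le_succ_mul (M := M) (Nat.zero_le q)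
      (t := y - (M + 1) * m0) (by simp) (by omega)
    refine ⟨m1 + q - a, m0 + a, 0, 0, M * m1 + M * q - b, M * m0 + b, 0, 0, ?_⟩
    omega
  · by_cases h0 : y + z = (M + 1) * m0
    · have key : x + y = (M + 1) * m0 + (M + 1) * m1 + (M + 1) * q := by omega
      obtain ⟨a, b, hab, -, ha, -, hb⟩ := exists_add_of_le_succ_mul (M := M) (Nat.zero_le m0)
        (t := y) (by simp) (by omega)
      refine ⟨m0 + m1 + q - a, a, m0 - a, 0, M * m0 + M * m1 + M * q - b, b, M * m0 - b, 0, ?_⟩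
      omega
    · have key : x + y = (M + 1) * m0 + (M + 1) * m1 + (M + 1) * q := by omega
      have key' : x + z = (M + 1) * m1 := by omega
      obtain ⟨a, b, hab, -, ha, -, hb⟩ := exists_add_of_le_succ_mul (M := M) (Nat.zero_le m1)
        (t := x) (by simp) (by omega)
      refine ⟨a, m0 + m1 + q - a, m1 - a, 0, b, M * m0 + M * m1 + M * q - b, M * m1 - b, 0, ?_⟩
      omega

lemma splits4_of_pairwise_sums {p q r M x y z s : ℕ}
    (h : VanishingIneqs ((M + 1) * (q + r)) ((M + 1) * (p + r)) ((M + 1) * (p + q)) x y z s) :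
    Splits4 (q + r) (p + r) (p + q) M x y z s := by
  refine splits4_of_forall ?_ _ x y z s rfl h
  clear h x y z s
  intro x y z s h hx hy hz hs
  simp only [VanishingIneqs, Splits4, mul_add] at *
  have gp : (M + 1) * p = M * p + p := by ring
  have gq : (M + 1) * q = M * q + q := by ring
  have gr : (M + 1) * r = M * r + r := by ring
  rcases Nat.eq_zero_or_pos s with rfl | hspos
  · have key : (x + z = (M + 1) * p + (M + 1) * r ∧ x + y = (M + 1) * p + (M + 1) * q) ∨
        (y + z = (M + 1) * q + (M + 1) * r ∧ x + y = (M + 1) * p + (M + 1) * q) ∨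
        (y + z = (M + 1) * q + (M + 1) * r ∧ x + z = (M + 1) * p + (M + 1) * r) := by
      omega
    rcases key with key | key | key
    · obtain ⟨a, b, hab, -, ha, -, hb⟩ := exists_add_of_le_succ_mul (M := M) (Nat.zero_le p)
        (t := x) (by simp) (by omega)
      refine ⟨a, p + q - a, p + r - a, 0, b, M * p + M * q - b, M * p + M * r - b, 0, ?_⟩
      omega
    · obtain ⟨a, b, hab, -, ha, -, hb⟩ := exists_add_of_le_succ_mul (M := M) (Nat.zero_le q)
        (t := y) (by simp) (by omega)
      refine ⟨p + q - a, a, q + r - a, 0, M * p + M * q - b, b, M * q + M * r - b, 0, ?_⟩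
      omega
    · obtain ⟨a, b, hab, -, ha, -, hb⟩ := exists_add_of_le_succ_mul (M := M) (Nat.zero_le r)
        (t := z) (by simp) (by omega)
      refine ⟨p + r - a, q + r - a, a, 0, M * p + M * r - b, M * q + M * r - b, b, 0, ?_⟩
      omega
  · obtain ⟨t, rfl⟩ : ∃ t, s = 2 * t := ⟨s / 2, by omega⟩
    have hx' : x + t = (M + 1) * p := by omega
    have hy' : y + t = (M + 1) * q := by omega
    have hz' : z + t = (M + 1) * r := by omega
    obtain ⟨u, hup, huq, hur, hu⟩ : ∃ u, u ≤ p ∧ u ≤ q ∧ u ≤ r ∧ (u = p ∨ u = q ∨ u = r) :=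
      ⟨min p (min q r), by omega⟩
    have ht : t ≤ (M + 1) * u := by
      rcases hu with rfl | rfl | rfl <;> omega
    obtain ⟨a, b, hab, -, ha, -, hb⟩ := exists_add_of_le_succ_mul (M := M) (Nat.zero_le u)
      (t := t) (by simp) ht
    have := Nat.mul_le_mul_left M hup
    have := Nat.mul_le_mul_left M huq
    have := Nat.mul_le_mul_left M hur
    refine ⟨p - a, q - a, r - a, 2 * a, M * p - b, M * q - b, M * r - b, 2 * b, ?_⟩
    omega

lemma image2_add_fatPointExponents {n m0 m1 m2 M : ℕ}
    (h : ∀ x y z s, VanishingIneqs ((M + 1) * m0) ((M + 1) * m1) ((M + 1) * m2) x y z s →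
      Splits4 m0 m1 m2 M x y z s) :
    Set.image2 (· + ·) (fatPointExponents n (M * m0) (M * m1) (M * m2))
      (fatPointExponents n m0 m1 m2) =
      fatPointExponents n ((M + 1) * m0) ((M + 1) * m1) ((M + 1) * m2) := by
  ext d
  constructor
  · rintro ⟨a, ha, b, hb, rfl⟩
    rw [mem_fatPointExponents_iff] at *
    simp only [Finsupp.add_apply, Finset.sum_add_distrib, add_mul, one_mul]
    omega
  · intro hd
    obtain ⟨a, b, c, e, a', b', c', e', h1, h2, h3, h4, h5, h6⟩ :=
      h _ _ _ _ (mem_fatPointExponents_iff.mp hd)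
    obtain ⟨u, hu, hue⟩ := exists_le_sum_eq (fun i : Fin n => d i.succ.succ.succ) e (by omega)
    let f : Fin (n + 2 + 1) →₀ ℕ := Finsupp.equivFunOnFinite.symm
      (Fin.cons a (Fin.cons b (Fin.cons c u)))
    have f0 : f 0 = a := rfl
    have f1 : f 1 = b := rfl
    have f2 : f 2 = c := rfl
    have fs : ∀ i : Fin n, f i.succ.succ.succ = u i := fun i => rfl
    have hfd : f ≤ d := by
      intro i
      refine Fin.cases ?_ (fun i => Fin.cases ?_ (fun i => Fin.cases ?_ (fun i => ?_) i) i) i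
      · change a ≤ d 0
        omega
      · change b ≤ d 1
        omega
      · change c ≤ d 2
        omega
      · exact hu i
    obtain ⟨g, rfl⟩ := exists_add_of_le hfd
    simp only [Finsupp.add_apply, Finset.sum_add_distrib, f0, f1, f2, fs, hue] at h1 h2 h3 h4
    refine ⟨g, ?_, f, ?_, add_comm _ _⟩
    · rw [mem_fatPointExponents_iff]
      unfold VanishingIneqs at h6
      omega
    · rw [mem_fatPointExponents_iff]
      simp only [f0, f1, f2, fs, hue]
      exact h5

lemma monomialIdeal_fatPointExponents_pow (K : Type*) [Field K] {n m0 m1 m2 : ℕ}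
    (h : ∀ M x y z s, VanishingIneqs ((M + 1) * m0) ((M + 1) * m1) ((M + 1) * m2) x y z s →
      Splits4 m0 m1 m2 M x y z s) (m : ℕ) :
    monomialIdeal K (fatPointExponents n (m * m0) (m * m1) (m * m2)) =
      monomialIdeal K (fatPointExponents n m0 m1 m2) ^ m := by
  induction m with
  | zero =>
    rw [pow_zero, Ideal.one_eq_top, Ideal.eq_top_iff_one, ← C_1, ← monomial_zero',
      monomial_mem_monomialIdeal]
    exact ⟨0, by simp [fatPointExponents], le_rfl⟩
  | succ M ih =>
    rw [pow_succ, ← ih, monomialIdeal_mul, image2_add_fatPointExponents (h M)]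

lemma even_of_monomialIdeal_fatPointExponents_sq (K : Type*) [Field K] {n m0 m1 m2 : ℕ}
    (h0 : m0 ≤ m1 + m2) (h1 : m1 ≤ m0 + m2) (h2 : m2 ≤ m0 + m1)
    (h : monomialIdeal K (fatPointExponents n (2 * m0) (2 * m1) (2 * m2)) =
      monomialIdeal K (fatPointExponents n m0 m1 m2) ^ 2) : Even (m0 + m1 + m2) := by
  let f : Fin (n + 2 + 1) →₀ ℕ := Finsupp.equivFunOnFinite.symm
    (Fin.cons (m1 + m2 - m0) (Fin.cons (m0 + m2 - m1) (Fin.cons (m0 + m1 - m2) 0)))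
  have f0 : f 0 = m1 + m2 - m0 := rfl
  have f1 : f 1 = m0 + m2 - m1 := rfl
  have f2 : f 2 = m0 + m1 - m2 := rfl
  have fs : ∀ i : Fin n, f i.succ.succ.succ = 0 := fun i => rfl
  have hf : monomial f (1 : K) ∈
      monomialIdeal K (fatPointExponents n (2 * m0) (2 * m1) (2 * m2)) := by
    rw [monomial_mem_monomialIdeal]
    refine ⟨f, ?_, le_rfl⟩
    rw [mem_fatPointExponents_iff]
    simp only [f0, f1, f2, fs]
    omega
  rw [h, sq, monomialIdeal_mul, monomial_mem_monomialIdeal] at hf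
  obtain ⟨_, ⟨a, ha, b, hb, rfl⟩, hle⟩ := hf
  rw [mem_fatPointExponents_iff] at ha hb
  have l0 := hle 0
  have l1 := hle 1
  have l2 := hle 2
  have ls := Finset.sum_le_sum (s := Finset.univ) fun (i : Fin n) _ => hle i.succ.succ.succ
  simp only [Finsupp.add_apply, Finset.sum_add_distrib, f0, f1, f2, fs,
    Finset.sum_const_zero] at l0 l1 l2 ls
  rw [Nat.even_iff]
  omega

/-- For the fat point scheme `Z = m_0 P_0 + m_1 P_1 + m_2 P_2` at three noncollinear
(coordinate) points of `P^N` with `m_2 ≥ max(m_0, m_1)`, one has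
`I(Z)^{(m)} = I(Z)^m` for all `m` (i.e. `sdefect(I(Z), m) = 0` for all `m`) iff
either `m_0 + m_1 ≤ m_2`, or `m_0 + m_1 > m_2` and `m_0 + m_1 + m_2` is even. -/
theorem three_points_symbolic_eq_ordinary_iff
    (K : Type*) [Field K] (N : ℕ) (hN : 2 ≤ N) (m0 m1 m2 : ℕ)
    (hmax : max m0 m1 ≤ m2) :
    (∀ m : ℕ,
      ptIdeal K N 0 ^ (m * m0) ⊓ ptIdeal K N 1 ^ (m * m1) ⊓ ptIdeal K N 2 ^ (m * m2) =
        (ptIdeal K N 0 ^ m0 ⊓ ptIdeal K N 1 ^ m1 ⊓ ptIdeal K N 2 ^ m2) ^ m) ↔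
    (m0 + m1 ≤ m2 ∨ (m2 < m0 + m1 ∧ Even (m0 + m1 + m2))) := by
  obtain ⟨n, rfl⟩ := Nat.exists_eq_add_of_le' hN
  simp only [inf_ptIdeal_pow_eq]
  have h0 : m0 ≤ m2 := le_of_max_le_left hmax
  have h1 : m1 ≤ m2 := le_of_max_le_right hmax
  constructor
  · intro h
    by_cases hm : m0 + m1 ≤ m2
    · exact Or.inl hm
    · exact Or.inr ⟨by omega, even_of_monomialIdeal_fatPointExponents_sq K (by omega) (by omega)
        (by omega) (h 2)⟩
  · rintro (hm | ⟨hm, k, hk⟩)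
    · exact monomialIdeal_fatPointExponents_pow K fun _ _ _ _ _ => splits4_of_add_le hm
    · obtain ⟨p, q, r, rfl, rfl, rfl⟩ : ∃ p q r, m0 = q + r ∧ m1 = p + r ∧ m2 = p + q :=
        ⟨k - m0, k - m1, k - m2, by omega⟩
      exact monomialIdeal_fatPointExponents_pow K fun _ _ _ _ _ => splits4_of_pairwise_sums
end

section
/- Let Z = m_0P_0 + m_1P_1 + m_2P_2 be a fat point scheme at three noncollinear points (taken to be the coordinate points) of P^N with max(m_0, m_1) ≤ m_2. If m_0 + m_1 > m_2 and m_0 + m_1 + m_2 is odd, then ρ(I(Z)) = (m_0 + m_1 + m_2 + 1)/(m_0 + m_1 + m_2). -/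
/-! ### Splitting exponent vectors

The multiplicities are written as `m₀ = q₁ + q₂ + 1`, `m₁ = q₀ + q₂ + 1`, `m₂ = q₀ + q₁ + 1`.
A monomial is recorded by its exponents `a₀, a₁, a₂` at `x₀, x₁, x₂` and its total degree `s` in
the other variables. -/

/-- `(u₀, u₁, u₂, v)` is the exponent vector of a monomial in the ideal of the fat points. -/
def FatExponent (q0 q1 q2 u0 u1 u2 v : ℕ) : Prop :=
  q1 + q2 + 1 ≤ u1 + u2 + v ∧ q0 + q2 + 1 ≤ u0 + u2 + v ∧ q0 + q1 + 1 ≤ u0 + u1 + v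

/-- `(a₀, a₁, a₂, s)` dominates a sum of `r` exponent vectors of monomials in the ideal of the
fat points. -/
def SplitsInto (q0 q1 q2 : ℕ) : ℕ → ℕ → ℕ → ℕ → ℕ → Prop
  | 0, _, _, _, _ => True
  | r + 1, a0, a1, a2, s => ∃ u0 u1 u2 v b0 b1 b2 t : ℕ, FatExponent q0 q1 q2 u0 u1 u2 v ∧
      SplitsInto q0 q1 q2 r b0 b1 b2 t ∧
      a0 = u0 + b0 ∧ a1 = u1 + b1 ∧ a2 = u2 + b2 ∧ s = v + t

namespace SplitsInto

variable {q0 q1 q2 : ℕ}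

theorem mono : ∀ {r a0 a1 a2 s c0 c1 c2 t : ℕ}, SplitsInto q0 q1 q2 r a0 a1 a2 s →
    a0 ≤ c0 → a1 ≤ c1 → a2 ≤ c2 → s ≤ t → SplitsInto q0 q1 q2 r c0 c1 c2 t
  | 0, _, _, _, _, _, _, _, _, _, _, _, _, _ => trivial
  | r + 1, a0, a1, a2, s, c0, c1, c2, t, h, h0, h1, h2, hs => by
    obtain ⟨u0, u1, u2, v, b0, b1, b2, w, hu, hb, e0, e1, e2, e3⟩ := h
    exact ⟨u0, u1, u2, v, c0 - u0, c1 - u1, c2 - u2, t - v, hu,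
      mono hb (by omega) (by omega) (by omega) (by omega),
      by omega, by omega, by omega, by omega⟩

theorem replace_zero : ∀ {r a0 a1 a2 s : ℕ}, SplitsInto q0 q1 q2 r (a0 + 1) a1 a2 s →
    SplitsInto q0 q1 q2 r a0 a1 a2 (s + 1)
  | 0, _, _, _, _, _ => trivial
  | r + 1, a0, a1, a2, s, h => by
    obtain ⟨u0, u1, u2, v, b0, b1, b2, w, hu, hb, e0, e1, e2, e3⟩ := h
    rcases b0 with _ | b0
    · exact ⟨a0, u1, u2, v + 1, 0, b1, b2, w, by unfold FatExponent at *; omega, hb,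
        by omega, by omega, by omega, by omega⟩
    · exact ⟨u0, u1, u2, v, b0, b1, b2, w + 1, hu, replace_zero hb,
        by omega, by omega, by omega, by omega⟩

theorem replace_one : ∀ {r a0 a1 a2 s : ℕ}, SplitsInto q0 q1 q2 r a0 (a1 + 1) a2 s →
    SplitsInto q0 q1 q2 r a0 a1 a2 (s + 1)
  | 0, _, _, _, _, _ => trivial
  | r + 1, a0, a1, a2, s, h => by
    obtain ⟨u0, u1, u2, v, b0, b1, b2, w, hu, hb, e0, e1, e2, e3⟩ := h
    rcases b1 with _ | b1
    · exact ⟨u0, a1, u2, v + 1, b0, 0, b2, w, by unfold FatExponent at *; omega, hb,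
        by omega, by omega, by omega, by omega⟩
    · exact ⟨u0, u1, u2, v, b0, b1, b2, w + 1, hu, replace_one hb,
        by omega, by omega, by omega, by omega⟩

theorem replace_two : ∀ {r a0 a1 a2 s : ℕ}, SplitsInto q0 q1 q2 r a0 a1 (a2 + 1) s →
    SplitsInto q0 q1 q2 r a0 a1 a2 (s + 1)
  | 0, _, _, _, _, _ => trivial
  | r + 1, a0, a1, a2, s, h => by
    obtain ⟨u0, u1, u2, v, b0, b1, b2, w, hu, hb, e0, e1, e2, e3⟩ := h
    rcases b2 with _ | b2
    · exact ⟨u0, u1, a2, v + 1, b0, b1, 0, w, by unfold FatExponent at *; omega, hb,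
        by omega, by omega, by omega, by omega⟩
    · exact ⟨u0, u1, u2, v, b0, b1, b2, w + 1, hu, replace_two hb,
        by omega, by omega, by omega, by omega⟩

/-- Splitting into the monomials of minimal weight `q₀ + q₁ + q₂ + 2`. -/
theorem of_minimal_weight : ∀ {r a0 a1 a2 s c0 c1 c2 : ℕ}, s + c0 + c1 + c2 = r →
    a0 = r * q0 + c1 + c2 → a1 = r * q1 + c0 + c2 → a2 = r * q2 + c0 + c1 →
    SplitsInto q0 q1 q2 r a0 a1 a2 s
  | 0, _, _, _, _, _, _, _, _, _, _, _ => trivial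
  | r + 1, a0, a1, a2, s, c0, c1, c2, hr, h0, h1, h2 => by
    rw [add_mul, one_mul] at h0 h1 h2
    have hpos : 0 < s ∨ 0 < c0 ∨ 0 < c1 ∨ 0 < c2 := by omega
    unfold SplitsInto FatExponent
    rcases hpos with h | h | h | h
    · exact ⟨q0, q1, q2, 1, a0 - q0, a1 - q1, a2 - q2, s - 1, by omega,
        of_minimal_weight (c0 := c0) (c1 := c1) (c2 := c2) (by omega) (by omega) (by omega)
          (by omega), by omega, by omega, by omega, by omega⟩
    · exact ⟨q0, q1 + 1, q2 + 1, 0, a0 - q0, a1 - (q1 + 1), a2 - (q2 + 1), s, by omega,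
        of_minimal_weight (c0 := c0 - 1) (c1 := c1) (c2 := c2) (by omega) (by omega) (by omega)
          (by omega), by omega, by omega, by omega, by omega⟩
    · exact ⟨q0 + 1, q1, q2 + 1, 0, a0 - (q0 + 1), a1 - q1, a2 - (q2 + 1), s, by omega,
        of_minimal_weight (c0 := c0) (c1 := c1 - 1) (c2 := c2) (by omega) (by omega) (by omega)
          (by omega), by omega, by omega, by omega, by omega⟩
    · exact ⟨q0 + 1, q1 + 1, q2, 0, a0 - (q0 + 1), a1 - (q1 + 1), a2 - q2, s, by omega,
        of_minimal_weight (c0 := c0) (c1 := c1) (c2 := c2 - 1) (by omega) (by omega) (by omega)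
          (by omega), by omega, by omega, by omega, by omega⟩

/-- Splitting when the order of vanishing is minimal at all three points. -/
theorem of_tight {μ : ℕ} (h0 : μ ≤ q0) (h1 : μ ≤ q1) (h2 : μ ≤ q2) :
    ∀ {r a0 a1 a2 s k : ℕ}, k ≤ r * μ → a0 + k = r * q0 → a1 + k = r * q1 → a2 + k = r * q2 →
      s = r + 2 * k → SplitsInto q0 q1 q2 r a0 a1 a2 s
  | 0, _, _, _, _, _, _, _, _, _, _ => trivial
  | r + 1, a0, a1, a2, s, k, hk, e0, e1, e2, e3 => by
    rw [add_mul, one_mul] at hk e0 e1 e2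
    have i0 := Nat.mul_le_mul_left r h0
    have i1 := Nat.mul_le_mul_left r h1
    have i2 := Nat.mul_le_mul_left r h2
    obtain ⟨l, hl, hl', hl''⟩ : ∃ l, l ≤ k ∧ l ≤ μ ∧ k ≤ r * μ + l :=
      ⟨min k μ, by omega, by omega, by omega⟩
    unfold SplitsInto FatExponent
    exact ⟨q0 - l, q1 - l, q2 - l, 1 + 2 * l, a0 - (q0 - l), a1 - (q1 - l), a2 - (q2 - l),
      s - (1 + 2 * l), by omega,
      of_tight h0 h1 h2 (k := k - l) (by omega) (by omega) (by omega) (by omega) (by omega),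
      by omega, by omega, by omega, by omega⟩

/-- Splitting when the order of vanishing is minimal at `P₁` and `P₂`. -/
theorem of_tight_one_two : ∀ {r a0 a1 a2 : ℕ}, a0 ≤ r * q0 →
    a0 + a2 = r * q0 + r * q2 + r → a0 + a1 = r * q0 + r * q1 + r →
    SplitsInto q0 q1 q2 r a0 a1 a2 0
  | 0, _, _, _, _, _, _ => trivial
  | r + 1, a0, a1, a2, h, h1, h2 => by
    simp only [add_mul, one_mul] at h h1 h2
    obtain ⟨l, hl, hl', hl''⟩ : ∃ l, l ≤ a0 ∧ l ≤ q0 ∧ a0 ≤ r * q0 + l :=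
      ⟨min a0 q0, by omega, by omega, by omega⟩
    unfold SplitsInto FatExponent
    exact ⟨l, q0 + q1 + 1 - l, q0 + q2 + 1 - l, 0, a0 - l, a1 - (q0 + q1 + 1 - l),
      a2 - (q0 + q2 + 1 - l), 0, by omega,
      of_tight_one_two (by omega) (by omega) (by omega), by omega, by omega, by omega, by omega⟩

/-- Splitting when the order of vanishing is minimal at `P₀` and `P₂`. -/
theorem of_tight_zero_two : ∀ {r a0 a1 a2 : ℕ}, a1 ≤ r * q1 →
    a1 + a2 = r * q1 + r * q2 + r → a0 + a1 = r * q0 + r * q1 + r →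
    SplitsInto q0 q1 q2 r a0 a1 a2 0
  | 0, _, _, _, _, _, _ => trivial
  | r + 1, a0, a1, a2, h, h1, h2 => by
    simp only [add_mul, one_mul] at h h1 h2
    obtain ⟨l, hl, hl', hl''⟩ : ∃ l, l ≤ a1 ∧ l ≤ q1 ∧ a1 ≤ r * q1 + l :=
      ⟨min a1 q1, by omega, by omega, by omega⟩
    unfold SplitsInto FatExponent
    exact ⟨q0 + q1 + 1 - l, l, q1 + q2 + 1 - l, 0, a0 - (q0 + q1 + 1 - l), a1 - l,
      a2 - (q1 + q2 + 1 - l), 0, by omega,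
      of_tight_zero_two (by omega) (by omega) (by omega), by omega, by omega, by omega, by omega⟩

/-- Splitting when the order of vanishing is minimal at `P₀` and `P₁`. -/
theorem of_tight_zero_one : ∀ {r a0 a1 a2 : ℕ}, a2 ≤ r * q2 →
    a1 + a2 = r * q1 + r * q2 + r → a0 + a2 = r * q0 + r * q2 + r →
    SplitsInto q0 q1 q2 r a0 a1 a2 0
  | 0, _, _, _, _, _, _ => trivial
  | r + 1, a0, a1, a2, h, h1, h2 => by
    simp only [add_mul, one_mul] at h h1 h2
    obtain ⟨l, hl, hl', hl''⟩ : ∃ l, l ≤ a2 ∧ l ≤ q2 ∧ a2 ≤ r * q2 + l :=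
      ⟨min a2 q2, by omega, by omega, by omega⟩
    unfold SplitsInto FatExponent
    exact ⟨q0 + q2 + 1 - l, q1 + q2 + 1 - l, l, 0, a0 - (q0 + q2 + 1 - l),
      a1 - (q1 + q2 + 1 - l), a2 - l, 0, by omega,
      of_tight_zero_one (by omega) (by omega) (by omega), by omega, by omega, by omega, by omega⟩

/-- The order of vanishing at the three points and the weight `a₀ + a₁ + a₂ + 2 s` decide whether
an exponent vector splits. -/
theorem of_le {r a0 a1 a2 s : ℕ} (h0 : r * q1 + r * q2 + r ≤ a1 + a2 + s)
    (h1 : r * q0 + r * q2 + r ≤ a0 + a2 + s) (h2 : r * q0 + r * q1 + r ≤ a0 + a1 + s)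
    (hw : r * q0 + r * q1 + r * q2 + 2 * r ≤ a0 + a1 + a2 + 2 * s) :
    SplitsInto q0 q1 q2 r a0 a1 a2 s := by
  induction hn : a0 + a1 + a2 + 2 * s using Nat.strong_induction_on generalizing a0 a1 a2 s with
  | _ n ih =>
  rcases Nat.eq_zero_or_pos r with rfl | hr
  · trivial
  rcases hw.eq_or_lt with hw' | hw'
  · exact of_minimal_weight (c0 := a1 + a2 + s - (r * q1 + r * q2 + r))
      (c1 := a0 + a2 + s - (r * q0 + r * q2 + r)) (c2 := a0 + a1 + s - (r * q0 + r * q1 + r))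
      (by omega) (by omega) (by omega) (by omega)
  rcases s with _ | s
  · by_cases d0 : 0 < a0 ∧ r * q0 + r * q2 + r < a0 + a2 ∧ r * q0 + r * q1 + r < a0 + a1
    · exact (ih _ (by omega) (a0 := a0 - 1) (s := 0) (by omega) (by omega) (by omega) (by omega)
        rfl).mono (by omega) le_rfl le_rfl le_rfl
    by_cases d1 : 0 < a1 ∧ r * q1 + r * q2 + r < a1 + a2 ∧ r * q0 + r * q1 + r < a0 + a1
    · exact (ih _ (by omega) (a1 := a1 - 1) (s := 0) (by omega) (by omega) (by omega) (by omega)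
        rfl).mono le_rfl (by omega) le_rfl le_rfl
    by_cases d2 : 0 < a2 ∧ r * q1 + r * q2 + r < a1 + a2 ∧ r * q0 + r * q2 + r < a0 + a2
    · exact (ih _ (by omega) (a2 := a2 - 1) (s := 0) (by omega) (by omega) (by omega) (by omega)
        rfl).mono le_rfl le_rfl (by omega) le_rfl
    by_cases t0 : r * q1 + r * q2 + r = a1 + a2
    · by_cases t1 : r * q0 + r * q2 + r = a0 + a2
      · exact of_tight_zero_one (by omega) (by omega) (by omega)
      · exact of_tight_zero_two (by omega) (by omega) (by omega)
    · exact of_tight_one_two (by omega) (by omega) (by omega)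
  · by_cases d0 : r * q1 + r * q2 + r < a1 + a2 + (s + 1)
    · exact replace_zero (ih _ (by omega) (by omega) (by omega) (by omega) (by omega) rfl)
    by_cases d1 : r * q0 + r * q2 + r < a0 + a2 + (s + 1)
    · exact replace_one (ih _ (by omega) (by omega) (by omega) (by omega) (by omega) rfl)
    by_cases d2 : r * q0 + r * q1 + r < a0 + a1 + (s + 1)
    · exact replace_two (ih _ (by omega) (by omega) (by omega) (by omega) (by omega) rfl)
    obtain ⟨μ, i0, i1, i2, hμ⟩ : ∃ μ, μ ≤ q0 ∧ μ ≤ q1 ∧ μ ≤ q2 ∧ (μ = q0 ∨ μ = q1 ∨ μ = q2) :=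
      ⟨min q0 (min q1 q2), by omega, by omega, by omega, by omega⟩
    refine of_tight i0 i1 i2 (k := r * q0 - a0) ?_ (by omega) (by omega) (by omega) (by omega)
    rcases hμ with rfl | rfl | rfl <;> omega

end SplitsInto

/-! ### Monomials in powers of point ideals -/

open MvPolynomial

/-- The ideal of polynomials all of whose monomials have weight at least `k`. -/
def weightIdeal {σ : Type*} (K : Type*) [Field K] (w : (σ →₀ ℕ) →+ ℕ) (k : ℕ) :
    Ideal (MvPolynomial σ K) where
  carrier := {f | ∀ d ∈ f.support, k ≤ w d}
  zero_mem' := by simp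
  add_mem' := by
    classical
    intro f g hf hg d hd
    rcases Finset.mem_union.1 (support_add hd) with h | h
    exacts [hf d h, hg d h]
  smul_mem' := by
    classical
    intro c f hf d hd
    obtain ⟨a, -, b, hb, rfl⟩ := Finset.mem_add.1 (support_mul c f hd)
    rw [map_add]
    exact (hf b hb).trans (Nat.le_add_left _ _)

theorem mem_weightIdeal {σ K : Type*} [Field K] {w : (σ →₀ ℕ) →+ ℕ} {k : ℕ}
    {f : MvPolynomial σ K} : f ∈ weightIdeal K w k ↔ ∀ d ∈ f.support, k ≤ w d := Iff.rfl

theorem weightIdeal_pow_le {σ K : Type*} [Field K] (w : (σ →₀ ℕ) →+ ℕ) (k r : ℕ) :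
    weightIdeal K w k ^ r ≤ weightIdeal K w (r * k) := by
  classical
  induction r with
  | zero => intro f _ d _; simp
  | succ r ih =>
    rw [pow_succ, Ideal.mul_le]
    intro f hf g hg d hd
    obtain ⟨a, ha, b, hb, rfl⟩ := Finset.mem_add.1 (support_mul f g hd)
    rw [map_add, add_mul, one_mul]
    exact add_le_add (ih hf a ha) (hg b hb)

/-- The weight of an exponent vector counting all variables except `x_j`. -/
noncomputable def weightAway {n : ℕ} (j : Fin n) : (Fin n →₀ ℕ) →+ ℕ where
  toFun d := ∑ i ∈ Finset.univ.erase j, d i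
  map_zero' := by simp
  map_add' := by simp [Finset.sum_add_distrib]

theorem weightAway_apply {n : ℕ} (j : Fin n) (d : Fin n →₀ ℕ) :
    weightAway j d = ∑ i ∈ Finset.univ.erase j, d i := rfl

theorem weightAway_add {n : ℕ} (j : Fin n) (d : Fin n →₀ ℕ) :
    weightAway j d + d j = ∑ i, d i :=
  Finset.sum_erase_add _ _ (Finset.mem_univ j)

theorem ptIdeal_pow_le_weightIdeal (K : Type*) [Field K] (N : ℕ) (j : Fin (N + 1)) (k : ℕ) :
    ptIdeal K N j ^ k ≤ weightIdeal K (weightAway j) k := by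
  classical
  have h : ptIdeal K N j ≤ weightIdeal K (weightAway j) 1 := by
    rw [ptIdeal, Ideal.span_le]
    rintro _ ⟨i, hi, rfl⟩ d hd
    rw [support_X, Finset.mem_singleton] at hd
    subst hd
    rw [weightAway_apply]
    calc 1 = (Finsupp.single i 1 : Fin (N + 1) →₀ ℕ) i := by simp
      _ ≤ _ := Finset.single_le_sum (f := fun l => (Finsupp.single i 1 : Fin (N + 1) →₀ ℕ) l)
          (fun _ _ => Nat.zero_le _) (by simp [hi])
  simpa using (Ideal.pow_right_mono h k).trans (weightIdeal_pow_le _ 1 k)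

theorem monomial_mem_ptIdeal_pow (K : Type*) [Field K] (N : ℕ) (j : Fin (N + 1)) {k : ℕ}
    {d : Fin (N + 1) →₀ ℕ} (hd : k ≤ weightAway j d) :
    monomial d (1 : K) ∈ ptIdeal K N j ^ k := by
  refine Ideal.pow_le_pow_right hd ?_
  rw [monomial_eq, C_1, one_mul, Finsupp.prod_fintype _ _ (by simp),
    ← Finset.prod_erase_mul _ _ (Finset.mem_univ j), weightAway_apply, ← Finset.prod_pow_eq_pow_sum]
  refine Ideal.mul_mem_right _ _ (Ideal.prod_mem_prod fun i hi => Ideal.pow_mem_pow ?_ _)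
  exact Ideal.subset_span ⟨i, Finset.ne_of_mem_erase hi, rfl⟩

/-- The total degree in the variables other than `x₀, x₁, x₂`. -/
def restDegree {n : ℕ} (d : Fin (n + 2 + 1) →₀ ℕ) : ℕ := ∑ i : Fin n, d i.succ.succ.succ

theorem sum_eq_add_restDegree {n : ℕ} (d : Fin (n + 2 + 1) →₀ ℕ) :
    ∑ i, d i = d 0 + d 1 + d 2 + restDegree d := by
  rw [Fin.sum_univ_succ, Fin.sum_univ_succ, Fin.sum_univ_succ, ← add_assoc, ← add_assoc]
  rfl

/-- The weight giving `x₀, x₁, x₂` weight one and every other variable weight two. -/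
noncomputable def doubledWeight (n : ℕ) : (Fin (n + 2 + 1) →₀ ℕ) →+ ℕ where
  toFun d := d 0 + d 1 + d 2 + 2 * restDegree d
  map_zero' := by simp [restDegree]
  map_add' a b := by
    simp only [restDegree, Finsupp.add_apply, Finset.sum_add_distrib]
    ring

theorem doubledWeight_apply {n : ℕ} (d : Fin (n + 2 + 1) →₀ ℕ) :
    doubledWeight n d = d 0 + d 1 + d 2 + 2 * restDegree d := rfl

/-- A family of natural numbers dominates a family with any prescribed smaller sum. -/
theorem exists_le_sum_eq_s2 {n : ℕ} (f : Fin n → ℕ) {v : ℕ} (hv : v ≤ ∑ i, f i) :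
    ∃ g : Fin n → ℕ, g ≤ f ∧ ∑ i, g i = v := by
  induction n generalizing v with
  | zero => exact ⟨f, le_rfl, by simp at hv; simp [hv]⟩
  | succ n ih =>
    rw [Fin.sum_univ_succ] at hv
    obtain ⟨g, hg, hs⟩ := ih (fun i => f i.succ) (v := v - min v (f 0)) (by omega)
    refine ⟨Fin.cons (min v (f 0)) g, ?_, ?_⟩
    · intro i
      refine Fin.cases ?_ (fun i => ?_) i
      · simp
      · simpa using hg i
    · rw [Fin.sum_univ_succ]
      simp only [Fin.cons_zero, Fin.cons_succ, hs]
      omega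

theorem exists_le_restDegree_eq {n : ℕ} (d : Fin (n + 2 + 1) →₀ ℕ) {u0 u1 u2 v : ℕ}
    (h0 : u0 ≤ d 0) (h1 : u1 ≤ d 1) (h2 : u2 ≤ d 2) (hv : v ≤ restDegree d) :
    ∃ c : Fin (n + 2 + 1) →₀ ℕ, c ≤ d ∧ c 0 = u0 ∧ c 1 = u1 ∧ c 2 = u2 ∧ restDegree c = v := by
  obtain ⟨g, hg, hs⟩ := exists_le_sum_eq_s2 (fun i : Fin n => d i.succ.succ.succ) hv
  refine ⟨Finsupp.equivFunOnFinite.symm (Fin.cons u0 (Fin.cons u1 (Fin.cons u2 g))),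
    ?_, rfl, rfl, rfl, ?_⟩
  · intro i
    refine Fin.cases h0 (fun i => ?_) i
    refine Fin.cases h1 (fun i => ?_) i
    refine Fin.cases h2 (fun i => ?_) i
    exact hg i
  · rw [← hs]
    rfl

theorem restDegree_add {n : ℕ} (c d : Fin (n + 2 + 1) →₀ ℕ) :
    restDegree (c + d) = restDegree c + restDegree d := by
  simp [restDegree, Finset.sum_add_distrib]

/-- The ideal of the fat point scheme `m₀ P₀ + m₁ P₁ + m₂ P₂`. -/
noncomputable def fatIdeal (K : Type*) [Field K] (N m0 m1 m2 : ℕ) :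
    Ideal (MvPolynomial (Fin (N + 1)) K) :=
  ptIdeal K N 0 ^ m0 ⊓ ptIdeal K N 1 ^ m1 ⊓ ptIdeal K N 2 ^ m2

section

variable {K : Type*} [Field K] {n : ℕ}

theorem monomial_mem_fatIdeal {m0 m1 m2 : ℕ} {d : Fin (n + 2 + 1) →₀ ℕ}
    (h0 : m0 ≤ d 1 + d 2 + restDegree d) (h1 : m1 ≤ d 0 + d 2 + restDegree d)
    (h2 : m2 ≤ d 0 + d 1 + restDegree d) :
    monomial d (1 : K) ∈ fatIdeal K (n + 2) m0 m1 m2 := by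
  have e := sum_eq_add_restDegree d
  have e0 := weightAway_add 0 d
  have e1 := weightAway_add 1 d
  have e2 := weightAway_add 2 d
  exact ⟨⟨monomial_mem_ptIdeal_pow K _ _ (by omega), monomial_mem_ptIdeal_pow K _ _ (by omega)⟩,
    monomial_mem_ptIdeal_pow K _ _ (by omega)⟩

theorem le_of_mem_fatIdeal {m0 m1 m2 : ℕ} {f : MvPolynomial (Fin (n + 2 + 1)) K}
    (hf : f ∈ fatIdeal K (n + 2) m0 m1 m2) {d : Fin (n + 2 + 1) →₀ ℕ} (hd : d ∈ f.support) :
    m0 ≤ d 1 + d 2 + restDegree d ∧ m1 ≤ d 0 + d 2 + restDegree d ∧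
      m2 ≤ d 0 + d 1 + restDegree d := by
  have e := sum_eq_add_restDegree d
  have e0 := weightAway_add 0 d
  have e1 := weightAway_add 1 d
  have e2 := weightAway_add 2 d
  have i0 := ptIdeal_pow_le_weightIdeal K _ _ _ hf.1.1 d hd
  have i1 := ptIdeal_pow_le_weightIdeal K _ _ _ hf.1.2 d hd
  have i2 := ptIdeal_pow_le_weightIdeal K _ _ _ hf.2 d hd
  omega

variable {q0 q1 q2 : ℕ}

theorem SplitsInto.monomial_mem {r a0 a1 a2 s : ℕ} (h : SplitsInto q0 q1 q2 r a0 a1 a2 s)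
    {d : Fin (n + 2 + 1) →₀ ℕ} (h0 : d 0 = a0) (h1 : d 1 = a1) (h2 : d 2 = a2)
    (hs : restDegree d = s) :
    monomial d (1 : K) ∈
      fatIdeal K (n + 2) (q1 + q2 + 1) (q0 + q2 + 1) (q0 + q1 + 1) ^ r := by
  induction r generalizing a0 a1 a2 s d with
  | zero => simp
  | succ r ih =>
    obtain ⟨u0, u1, u2, v, b0, b1, b2, t, hu, hb, e0, e1, e2, e3⟩ := h
    obtain ⟨c, hc, hc0, hc1, hc2, hcv⟩ := exists_le_restDegree_eq d (u0 := u0) (u1 := u1)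
      (u2 := u2) (v := v) (by omega) (by omega) (by omega) (by omega)
    obtain ⟨b, rfl⟩ := exists_add_of_le hc
    rw [restDegree_add] at hs
    simp only [Finsupp.add_apply] at h0 h1 h2
    rw [← one_mul (1 : K), ← monomial_mul, pow_succ']
    unfold FatExponent at hu
    exact Ideal.mul_mem_mul
      (monomial_mem_fatIdeal (by omega) (by omega) (by omega))
      (ih hb (by omega) (by omega) (by omega) (by omega))

/-- Containment of a symbolic power in an ordinary power. -/
theorem fatIdeal_le_pow {m r : ℕ}
    (h : r * (2 * (q0 + q1 + q2) + 4) ≤ m * (2 * (q0 + q1 + q2) + 3)) :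
    fatIdeal K (n + 2) (m * (q1 + q2 + 1)) (m * (q0 + q2 + 1)) (m * (q0 + q1 + 1)) ≤
      fatIdeal K (n + 2) (q1 + q2 + 1) (q0 + q2 + 1) (q0 + q1 + 1) ^ r := by
  intro f hf
  have hrm : r ≤ m := by
    by_contra hlt
    have : m * (2 * (q0 + q1 + q2) + 3) < r * (2 * (q0 + q1 + q2) + 4) :=
      Nat.mul_lt_mul_of_lt_of_le (by omega) (by omega) (by omega)
    omega
  rw [f.as_sum]
  refine Ideal.sum_mem _ fun d hd => ?_
  obtain ⟨h0, h1, h2⟩ := le_of_mem_fatIdeal hf hd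
  have i0 := Nat.mul_le_mul_right q0 hrm
  have i1 := Nat.mul_le_mul_right q1 hrm
  have i2 := Nat.mul_le_mul_right q2 hrm
  ring_nf at h h0 h1 h2 i0 i1 i2
  have key : SplitsInto q0 q1 q2 r (d 0) (d 1) (d 2) (restDegree d) := by
    apply SplitsInto.of_le <;> ring_nf <;> omega
  rw [← mul_one (coeff d f), ← C_mul_monomial]
  exact Ideal.mul_mem_left _ _ (key.monomial_mem rfl rfl rfl rfl)

/-- Failure of containment of a symbolic power in an ordinary power. -/
theorem not_fatIdeal_le_pow {m r : ℕ} (k : ℕ) (hm : m = 2 * k)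
    (h : k * (2 * (q0 + q1 + q2) + 3) < r * (q0 + q1 + q2 + 2)) :
    ¬ fatIdeal K (n + 2) (m * (q1 + q2 + 1)) (m * (q0 + q2 + 1)) (m * (q0 + q1 + 1)) ≤
      fatIdeal K (n + 2) (q1 + q2 + 1) (q0 + q2 + 1) (q0 + q1 + 1) ^ r := by
  classical
  intro hle
  subst hm
  let d : Fin (n + 2 + 1) →₀ ℕ := Finsupp.equivFunOnFinite.symm
    (Fin.cons (k * (2 * q0 + 1)) (Fin.cons (k * (2 * q1 + 1)) (Fin.cons (k * (2 * q2 + 1)) 0)))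
  have d0 : d 0 = k * (2 * q0 + 1) := rfl
  have d1 : d 1 = k * (2 * q1 + 1) := rfl
  have d2 : d 2 = k * (2 * q2 + 1) := rfl
  have ds : restDegree d = 0 := Finset.sum_eq_zero fun _ _ => rfl
  have hI : fatIdeal K (n + 2) (q1 + q2 + 1) (q0 + q2 + 1) (q0 + q1 + 1) ≤
      weightIdeal K (doubledWeight n) (q0 + q1 + q2 + 2) := by
    intro f hf c hc
    obtain ⟨h0, h1, h2⟩ := le_of_mem_fatIdeal hf hc
    rw [doubledWeight_apply]
    omega
  have hd : monomial d (1 : K) ∈ fatIdeal K (n + 2) (2 * k * (q1 + q2 + 1))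
      (2 * k * (q0 + q2 + 1)) (2 * k * (q0 + q1 + 1)) :=
    monomial_mem_fatIdeal (by rw [d1, d2, ds]; apply le_of_eq; ring)
      (by rw [d0, d2, ds]; apply le_of_eq; ring) (by rw [d0, d1, ds]; apply le_of_eq; ring)
  have hw := weightIdeal_pow_le _ _ _ (Ideal.pow_right_mono hI r (hle hd)) d
    (by simp [mem_support_iff])
  rw [doubledWeight_apply, d0, d1, d2, ds] at hw
  have : k * (2 * q0 + 1) + k * (2 * q1 + 1) + k * (2 * q2 + 1) + 2 * 0 =
      k * (2 * (q0 + q1 + q2) + 3) := by ring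
  omega

end

/-- For `Z = m_0 P_0 + m_1 P_1 + m_2 P_2` at three noncollinear (coordinate) points of `P^N`
with `max(m_0, m_1) ≤ m_2`, if `m_0 + m_1 > m_2` and `m_0 + m_1 + m_2` is odd, then
`ρ(I(Z)) = (m_0 + m_1 + m_2 + 1)/(m_0 + m_1 + m_2)`. -/
theorem three_points_resurgence_odd_case
    (K : Type*) [Field K] (N : ℕ) (hN : 2 ≤ N) (m0 m1 m2 : ℕ)
    (hmax : max m0 m1 ≤ m2) (hgt : m2 < m0 + m1) (hodd : Odd (m0 + m1 + m2)) :
    resurgence (ptIdeal K N 0 ^ m0 ⊓ ptIdeal K N 1 ^ m1 ⊓ ptIdeal K N 2 ^ m2)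
      (fun m =>
        ptIdeal K N 0 ^ (m * m0) ⊓ ptIdeal K N 1 ^ (m * m1) ⊓ ptIdeal K N 2 ^ (m * m2)) =
      ((m0 : ℝ) + m1 + m2 + 1) / ((m0 : ℝ) + m1 + m2) := by
  obtain ⟨n, rfl⟩ := Nat.exists_eq_add_of_le' hN
  obtain ⟨q0, q1, q2, rfl, rfl, rfl⟩ : ∃ q0 q1 q2 : ℕ,
      m0 = q1 + q2 + 1 ∧ m1 = q0 + q2 + 1 ∧ m2 = q0 + q1 + 1 := by
    obtain ⟨l, hl⟩ := hodd
    exact ⟨l - m0, l - m1, l - m2, by omega, by omega, by omega⟩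
  obtain ⟨c, hc⟩ : ∃ c : ℕ, c = 2 * (q0 + q1 + q2) + 3 := ⟨_, rfl⟩
  have hcast : (((q1 + q2 + 1 : ℕ) : ℝ) + ((q0 + q2 + 1 : ℕ) : ℝ) + ((q0 + q1 + 1 : ℕ) : ℝ)) =
      (c : ℝ) := by
    rw [hc]; push_cast; ring
  have hcpos : (0 : ℝ) < c := by rw [hc]; positivity
  rw [hcast]
  change sSup {x : ℝ | ∃ m r : ℕ, 0 < m ∧ 0 < r ∧
    ¬ fatIdeal K (n + 2) (m * (q1 + q2 + 1)) (m * (q0 + q2 + 1)) (m * (q0 + q1 + 1)) ≤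
      fatIdeal K (n + 2) (q1 + q2 + 1) (q0 + q2 + 1) (q0 + q1 + 1) ^ r ∧
    x = (m : ℝ) / (r : ℝ)} = _
  set S := {x : ℝ | ∃ m r : ℕ, 0 < m ∧ 0 < r ∧
    ¬ fatIdeal K (n + 2) (m * (q1 + q2 + 1)) (m * (q0 + q2 + 1)) (m * (q0 + q1 + 1)) ≤
      fatIdeal K (n + 2) (q1 + q2 + 1) (q0 + q2 + 1) (q0 + q1 + 1) ^ r ∧
    x = (m : ℝ) / (r : ℝ)}
  have upper : ∀ x ∈ S, x ≤ ((c : ℝ) + 1) / c := by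
    rintro x ⟨m, r, -, hr, hnot, rfl⟩
    have hlt : m * c < r * (c + 1) := by
      by_contra hge
      exact hnot (fatIdeal_le_pow (by rw [hc] at hge; exact not_lt.1 hge))
    rw [div_le_div_iff₀ (by exact_mod_cast hr) hcpos, mul_comm ((c : ℝ) + 1)]
    exact_mod_cast hlt.le
  have lower : ∀ t : ℕ, 0 < t → ((t : ℝ) * (c + 1)) / (t * c + 1) ∈ S := by
    intro t ht
    refine ⟨t * (c + 1), t * c + 1, by positivity, by positivity,
      not_fatIdeal_le_pow (t * (q0 + q1 + q2 + 2)) (by rw [hc]; ring) ?_, by push_cast; rfl⟩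
    rw [hc]
    calc t * (q0 + q1 + q2 + 2) * (2 * (q0 + q1 + q2) + 3)
        < t * (q0 + q1 + q2 + 2) * (2 * (q0 + q1 + q2) + 3) + (q0 + q1 + q2 + 2) := by omega
      _ = _ := by ring
  refine le_antisymm (csSup_le ⟨_, lower 1 one_pos⟩ upper) ?_
  have bdd : BddAbove S := ⟨_, upper⟩
  rw [div_le_iff₀ hcpos]
  by_contra hlt
  rw [not_le] at hlt
  obtain ⟨t, ht⟩ := exists_nat_gt (sSup S / ((c : ℝ) + 1 - sSup S * c))
  rw [div_lt_iff₀ (by linarith)] at ht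
  have hle := le_csSup bdd (lower (t + 1) t.succ_pos)
  rw [div_le_iff₀ (by positivity)] at hle
  push_cast at hle
  nlinarith
end

section
/- Let P_1,…,P_n be distinct points on the line x_2 = ⋯ = x_N = 0 in P^N, and let 0 = m_0 ≤ m_1 ≤ ⋯ ≤ m_n be nonnegative integers (m_0 being a formal zero). For i = 1,…,n set Z_i = P_i + P_{i+1} + ⋯ + P_n (the reduced scheme of the last n−i+1 points), so I(Z_i) = ⋂_{j=i}^n I(P_j). Then for every m ∈ ℕ: ⋂_{i=1}^n I(P_i)^{m·m_i} = ∏_{i=1}^n (⋂_{j=i}^n I(P_j))^{m·m_i − m·m_{i−1}}, i.e. I(mZ) = ∏_{i=1}^n I((m·m_i − m·m_{i−1})Z_i). -/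
/-- Telescoping sum of truncated differences of a sequence that is monotone up to `j`. -/
theorem sum_Icc_tsub_pred (b : ℕ → ℕ) (j : ℕ) (hb : ∀ i < j, b i ≤ b (i + 1)) :
    ∑ i ∈ Finset.Icc 1 j, (b i - b (i - 1)) = b j - b 0 := by
  induction j with
  | zero => simp
  | succ j ih =>
    rw [Finset.sum_Icc_succ_top (by omega), ih fun i hi => hb i (by omega)]
    have h1 := hb j (by omega)
    have h2 : b 0 ≤ b j := by
      clear ih h1
      induction j with
      | zero => exact le_rfl
      | succ j ih => exact (ih fun i hi => hb i (by omega)).trans (hb j (by omega))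
    simp only [Nat.add_sub_cancel]
    omega

/-- A product of powers of intersections of tails of a family of ideals lies in the
intersection of the corresponding powers. -/
theorem prod_iInf_pow_le {R : Type*} [CommRing R] (n : ℕ) (I : ℕ → Ideal R) (a : ℕ → ℕ)
    (h0 : a 0 = 0) (ha : ∀ i < n, a i ≤ a (i + 1)) :
    ∏ i ∈ Finset.Icc 1 n, (⨅ j ∈ Finset.Icc i n, I j) ^ (a i - a (i - 1)) ≤
      ⨅ i ∈ Finset.Icc 1 n, I i ^ a i := by
  refine le_iInf₂ fun j hj => ?_
  rw [Finset.mem_Icc] at hj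
  calc _ ≤ ∏ i ∈ Finset.Icc 1 j, (⨅ j ∈ Finset.Icc i n, I j) ^ (a i - a (i - 1)) := by
        refine Ideal.le_of_dvd (Finset.prod_dvd_prod_of_subset _ _ _ ?_)
        exact Finset.Icc_subset_Icc le_rfl hj.2
    _ ≤ ∏ i ∈ Finset.Icc 1 j, I j ^ (a i - a (i - 1)) := by
        refine Finset.prod_le_prod' fun i hi => ?_
        rw [Finset.mem_Icc] at hi
        exact Ideal.pow_right_mono (iInf₂_le j (Finset.mem_Icc.2 ⟨hi.2, hj.2⟩)) _
    _ = I j ^ a j := by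
        rw [Finset.prod_pow_eq_pow_sum,
          sum_Icc_tsub_pred a j fun i hi => ha i (by omega), h0, Nat.sub_zero]

/-- If each `B i` contains `J` and the tail product `∏ j ∈ Icc i n, l j`, then
`(∏ j, l j ^ (a j - t)) * J ^ t` is contained in `∏ i, B i ^ (a i - a (i - 1))`. -/
theorem prod_pow_tsub_mul_mem {R : Type*} [CommRing R] (n : ℕ) (J : Ideal R) (B : ℕ → Ideal R)
    (l : ℕ → R) (a : ℕ → ℕ) (h0 : a 0 = 0) (ha : ∀ i < n, a i ≤ a (i + 1))
    (hJ : ∀ i ∈ Finset.Icc 1 n, J ≤ B i)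
    (hl : ∀ i ∈ Finset.Icc 1 n, ∏ j ∈ Finset.Icc i n, l j ∈ B i)
    (t : ℕ) {x : R} (hx : x ∈ J ^ t) :
    (∏ j ∈ Finset.Icc 1 n, l j ^ (a j - t)) * x ∈
      ∏ i ∈ Finset.Icc 1 n, B i ^ (a i - a (i - 1)) := by
  have hprod : ∏ j ∈ Finset.Icc 1 n, l j ^ (a j - t) =
      ∏ i ∈ Finset.Icc 1 n,
        (∏ j ∈ Finset.Icc i n, l j) ^ ((a i - t) - (a (i - 1) - t)) := by
    simp_rw [← Finset.prod_pow]
    rw [Finset.prod_comm' (t' := Finset.Icc 1 n) (s' := fun j => Finset.Icc 1 j)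
      (by intro i j; simp only [Finset.mem_Icc]; omega)]
    refine Finset.prod_congr rfl fun j hj => ?_
    rw [Finset.mem_Icc] at hj
    rw [Finset.prod_pow_eq_pow_sum, sum_Icc_tsub_pred (fun i => a i - t) j, h0]
    · simp
    · intro i hi
      have := ha i (by omega)
      omega
  have hx' : x ∈ ∏ i ∈ Finset.Icc 1 n, B i ^ (min (a i) t - min (a (i - 1)) t) := by
    have hle : ∏ i ∈ Finset.Icc 1 n, J ^ (min (a i) t - min (a (i - 1)) t) ≤
        ∏ i ∈ Finset.Icc 1 n, B i ^ (min (a i) t - min (a (i - 1)) t) :=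
      Finset.prod_le_prod' fun i hi => Ideal.pow_right_mono (hJ i hi) _
    refine hle ?_
    rw [Finset.prod_pow_eq_pow_sum, sum_Icc_tsub_pred (fun i => min (a i) t) n]
    · exact Ideal.pow_le_pow_right (by simp) hx
    · intro i hi
      have := ha i hi
      omega
  have hsplit : ∏ i ∈ Finset.Icc 1 n, B i ^ (a i - a (i - 1)) =
      (∏ i ∈ Finset.Icc 1 n, B i ^ ((a i - t) - (a (i - 1) - t))) *
        ∏ i ∈ Finset.Icc 1 n, B i ^ (min (a i) t - min (a (i - 1)) t) := by
    rw [← Finset.prod_mul_distrib]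
    refine Finset.prod_congr rfl fun i hi => ?_
    rw [Finset.mem_Icc] at hi
    have := ha (i - 1) (by omega)
    rw [Nat.sub_add_cancel hi.1] at this
    rw [← pow_add]
    congr 1
    omega
  rw [hsplit, hprod]
  exact Ideal.mul_mem_mul
    (Ideal.prod_mem_prod fun i hi => Ideal.pow_mem_pow (hl i hi) _) hx'

/-- The ideal of polynomials over `S` whose coefficient at `β` is divisible by
`L ^ (a - |β|)`. -/
def coeffDvdIdeal (σ : Type*) {S : Type*} [CommRing S] (L : S) (a : ℕ) :
    Ideal (MvPolynomial σ S) where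
  carrier := {f | ∀ β : σ →₀ ℕ, L ^ (a - β.degree) ∣ MvPolynomial.coeff β f}
  add_mem' hf hg β := by
    rw [MvPolynomial.coeff_add]
    exact dvd_add (hf β) (hg β)
  zero_mem' β := by simp
  smul_mem' g f hf β := by
    classical
    rw [smul_eq_mul, MvPolynomial.coeff_mul]
    refine Finset.dvd_sum fun p hp => Dvd.dvd.mul_left ?_ _
    rw [Finset.HasAntidiagonal.mem_antidiagonal] at hp
    refine (pow_dvd_pow L ?_).trans (hf p.2)
    rw [← hp, map_add]
    omega

theorem mem_coeffDvdIdeal {σ S : Type*} [CommRing S] {L : S} {a : ℕ} {f : MvPolynomial σ S} :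
    f ∈ coeffDvdIdeal σ L a ↔
      ∀ β : σ →₀ ℕ, L ^ (a - β.degree) ∣ MvPolynomial.coeff β f :=
  Iff.rfl

theorem coeffDvdIdeal_mul_le {σ S : Type*} [CommRing S] (L : S) (a b : ℕ) :
    coeffDvdIdeal σ L a * coeffDvdIdeal σ L b ≤ coeffDvdIdeal σ L (a + b) := by
  classical
  refine Ideal.mul_le.2 fun f hf g hg β => ?_
  rw [MvPolynomial.coeff_mul]
  refine Finset.dvd_sum fun p hp => ?_
  rw [Finset.HasAntidiagonal.mem_antidiagonal] at hp
  refine (pow_dvd_pow L ?_).trans ((pow_add L _ _).symm ▸ mul_dvd_mul (hf p.1) (hg p.2))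
  rw [← hp, map_add]
  omega

theorem coeffDvdIdeal_one_pow_le {σ S : Type*} [CommRing S] (L : S) (a : ℕ) :
    coeffDvdIdeal σ L 1 ^ a ≤ coeffDvdIdeal σ L a := by
  induction a with
  | zero => exact fun f _ => mem_coeffDvdIdeal.2 (by simp)
  | succ a ih =>
    rw [pow_succ]
    exact (Ideal.mul_mono_left ih).trans (coeffDvdIdeal_mul_le L a 1)

theorem C_mem_coeffDvdIdeal_one {σ S : Type*} [CommRing S] (L : S) :
    MvPolynomial.C L ∈ coeffDvdIdeal σ L 1 := by
  classical
  intro β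
  rw [MvPolynomial.coeff_C]
  split_ifs with h
  · simp [← h]
  · simp

theorem X_mem_coeffDvdIdeal_one {σ S : Type*} [CommRing S] (L : S) (i : σ) :
    MvPolynomial.X i ∈ coeffDvdIdeal σ L 1 := by
  classical
  intro β
  rw [MvPolynomial.coeff_X]
  split_ifs with h
  · simp [← h]
  · simp

/-- Two non-proportional linear forms in two variables have no common factor. -/
theorem isRelPrime_linearForms {K σ : Type*} [Field K] {i j : σ} (hij : i ≠ j) {c d c' d' : K}
    (h : c * d' - c' * d ≠ 0) :
    IsRelPrime (MvPolynomial.C c * MvPolynomial.X i + MvPolynomial.C d * MvPolynomial.X j)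
      (MvPolynomial.C c' * MvPolynomial.X i + MvPolynomial.C d' * MvPolynomial.X j) := by
  intro g hg hg'
  have hu : IsUnit (MvPolynomial.C (c * d' - c' * d) : MvPolynomial σ K) :=
    (isUnit_iff_ne_zero.2 h).map MvPolynomial.C
  have hi : g ∣ MvPolynomial.X i := by
    rw [← hu.dvd_mul_left]
    convert dvd_sub (hg.mul_left (MvPolynomial.C d')) (hg'.mul_left (MvPolynomial.C d)) using 1
    simp only [map_sub, map_mul]
    ring
  have hj : g ∣ MvPolynomial.X j := by
    rw [← hu.dvd_mul_left]
    convert dvd_sub (hg'.mul_left (MvPolynomial.C c)) (hg.mul_left (MvPolynomial.C c')) using 1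
    simp only [map_sub, map_mul]
    ring
  have hX : IsRelPrime (MvPolynomial.X i : MvPolynomial σ K) (MvPolynomial.X j) :=
    (MvPolynomial.X_prime.irreducible.isRelPrime_iff_not_dvd).2
      fun hd => hij (by simpa using hd)
  exact hX hi hj

/-- The embedding of `K[x_0, …, x_N]` into polynomials over itself that treats the variables
`x_0, x_1` as coefficients. -/
noncomputable def splitVars (K : Type*) [Field K] (N : ℕ) :
    MvPolynomial (Fin (N + 1)) K →ₐ[K]
      MvPolynomial (Fin (N + 1)) (MvPolynomial (Fin (N + 1)) K) :=
  MvPolynomial.aeval fun i =>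
    if 2 ≤ (i : ℕ) then MvPolynomial.X i else MvPolynomial.C (MvPolynomial.X i)

/-- A left inverse of `splitVars`, killing the outer variables `x_0, x_1`. -/
noncomputable def mergeVars (K : Type*) [Field K] (N : ℕ) :
    MvPolynomial (Fin (N + 1)) (MvPolynomial (Fin (N + 1)) K) →ₐ[MvPolynomial (Fin (N + 1)) K]
      MvPolynomial (Fin (N + 1)) K :=
  MvPolynomial.aeval fun i => if 2 ≤ (i : ℕ) then MvPolynomial.X i else 0

theorem mergeVars_splitVars (K : Type*) [Field K] (N : ℕ) (f : MvPolynomial (Fin (N + 1)) K) :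
    mergeVars K N (splitVars K N f) = f := by
  have h : ((mergeVars K N).restrictScalars K).comp (splitVars K N) = AlgHom.id K _ := by
    ext1 i
    by_cases hi : 2 ≤ (i : ℕ) <;> simp [mergeVars, splitVars, hi]
  exact DFunLike.congr_fun h f

theorem map_splitVars_linePtIdeal_le (K : Type*) [Field K] (N : ℕ) (hN : 2 ≤ N) (c d : K) :
    (linePtIdeal K N c d).map (splitVars K N) ≤
      coeffDvdIdeal (Fin (N + 1))
        (MvPolynomial.C c * MvPolynomial.X 0 + MvPolynomial.C d * MvPolynomial.X 1) 1 := by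
  have h1 : 1 % (N + 1) = 1 := Nat.mod_eq_of_lt (by omega)
  rw [Ideal.map_le_iff_le_comap, linePtIdeal, Ideal.span_le]
  rintro f (rfl | ⟨i, hi, rfl⟩)
  · rw [SetLike.mem_coe, Ideal.mem_comap]
    convert C_mem_coeffDvdIdeal_one (σ := Fin (N + 1))
      (MvPolynomial.C c * MvPolynomial.X 0 + MvPolynomial.C d * MvPolynomial.X 1 :
        MvPolynomial (Fin (N + 1)) K) using 1
    simp [splitVars, h1, MvPolynomial.algebraMap_apply]
  · rw [SetLike.mem_coe, Ideal.mem_comap]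
    convert X_mem_coeffDvdIdeal_one _ i using 1
    simp [splitVars, hi]

theorem mergeVars_monomial_one_mem (K : Type*) [Field K] (N : ℕ) (β : Fin (N + 1) →₀ ℕ) :
    mergeVars K N (MvPolynomial.monomial β 1) ∈
      Ideal.span {f : MvPolynomial (Fin (N + 1)) K |
        ∃ i : Fin (N + 1), 2 ≤ (i : ℕ) ∧ f = MvPolynomial.X i} ^ β.degree := by
  rw [mergeVars, MvPolynomial.aeval_monomial, map_one, one_mul, Finsupp.degree_apply,
    ← Finset.prod_pow_eq_pow_sum, Finsupp.prod]
  refine Ideal.prod_mem_prod fun i _ => Ideal.pow_mem_pow ?_ _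
  split_ifs with hi
  · exact Ideal.subset_span ⟨i, hi, rfl⟩
  · exact zero_mem _


/-- Splitting of the ideal of a collinear fat point scheme (Lemma 2.4):
for distinct collinear points `P_1, …, P_n` and multiplicities
`0 = μ(0) ≤ μ(1) ≤ ⋯ ≤ μ(n)`, with `Z_i = P_i + ⋯ + P_n`, one has
`I(mZ) = ∏_{i=1}^n I((m·μ(i) − m·μ(i−1)) Z_i)` for every `m`. -/
theorem collinear_fat_points_splitting
    (K : Type*) [Field K] (N n : ℕ) (hN : 2 ≤ N) (hn : 1 ≤ n)
    (c d : ℕ → K)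
    (hcd : ∀ i ∈ Finset.Icc 1 n, ¬(c i = 0 ∧ d i = 0))
    (hdist : ∀ i ∈ Finset.Icc 1 n, ∀ j ∈ Finset.Icc 1 n, i ≠ j →
      c i * d j - c j * d i ≠ 0)
    (μ : ℕ → ℕ) (h0 : μ 0 = 0)
    (hmono : ∀ i j : ℕ, i ≤ j → j ≤ n → μ i ≤ μ j)
    (m : ℕ) :
    (⨅ i ∈ Finset.Icc 1 n, linePtIdeal K N (c i) (d i) ^ (m * μ i)) =
      ∏ i ∈ Finset.Icc 1 n,
        (⨅ j ∈ Finset.Icc i n, linePtIdeal K N (c j) (d j)) ^ (m * μ i - m * μ (i - 1)) := by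
  have ha : ∀ i < n, m * μ i ≤ m * μ (i + 1) := fun i hi =>
    Nat.mul_le_mul_left m (hmono i (i + 1) (by omega) (by omega))
  refine le_antisymm (fun f hf => ?_)
    (prod_iInf_pow_le n (fun i => linePtIdeal K N (c i) (d i)) (fun i => m * μ i)
      (by simp [h0]) ha)
  let l : ℕ → MvPolynomial (Fin (N + 1)) K := fun i =>
    MvPolynomial.C (c i) * MvPolynomial.X 0 + MvPolynomial.C (d i) * MvPolynomial.X 1
  have hl (i : ℕ) : l i ∈ linePtIdeal K N (c i) (d i) := Ideal.subset_span (Or.inl rfl)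
  have h01 : (0 : Fin (N + 1)) ≠ 1 := by
    rw [Ne, Fin.ext_iff, Fin.val_one', Nat.mod_eq_of_lt (by omega)]
    simp
  have hdvd (β : Fin (N + 1) →₀ ℕ) : ∏ j ∈ Finset.Icc 1 n, l j ^ (m * μ j - β.degree) ∣
      MvPolynomial.coeff β (splitVars K N f) := by
    refine Finset.prod_dvd_of_isRelPrime (fun i hi j hj hij => ?_) fun i hi => ?_
    · exact (isRelPrime_linearForms h01 (hdist i hi j hj hij)).pow
    · have hfi : f ∈ linePtIdeal K N (c i) (d i) ^ (m * μ i) := by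
        simp only [Ideal.mem_iInf] at hf
        exact hf i hi
      have hmem := Ideal.mem_map_of_mem (splitVars K N) hfi
      rw [Ideal.map_pow] at hmem
      exact coeffDvdIdeal_one_pow_le _ _
        (Ideal.pow_right_mono (map_splitVars_linePtIdeal_le K N hN (c i) (d i)) _ hmem) β
  rw [← mergeVars_splitVars K N f, (splitVars K N f).as_sum, map_sum]
  refine Ideal.sum_mem _ fun β _ => ?_
  obtain ⟨s, hs⟩ := hdvd β
  rw [hs, ← mul_one (_ * s), ← smul_eq_mul (_ * s), ← MvPolynomial.smul_monomial, map_smul,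
    smul_eq_mul, mul_right_comm]
  refine Ideal.mul_mem_right _ _ (prod_pow_tsub_mul_mem n _
    (fun i => ⨅ j ∈ Finset.Icc i n, linePtIdeal K N (c j) (d j)) l (fun i => m * μ i)
    (by simp [h0]) ha (fun i _ => ?_) (fun i _ => ?_) _ (mergeVars_monomial_one_mem K N β))
  · exact le_iInf₂ fun j _ => Ideal.span_mono Set.subset_union_right
  · simp only [Ideal.mem_iInf]
    exact fun j hj => Ideal.mem_of_dvd _ (Finset.dvd_prod_of_mem l hj) (hl j)
end

section
/- Let q : R → R' be the K-algebra homomorphism from K[x_0,…,x_N] to K[x_0,x_1,x_2] sending x_i ↦ x_i for i = 0,1,2 and x_i ↦ 0 for i ≥ 3. Let m_0, m_1, m_2 be nonnegative integers and m, r positive integers. If ⋂_{i=0}^2 I(P_i)^{m·m_i} ⊆ (⋂_{i=0}^2 I(P_i)^{m_i})^r holds in R, then ⋂_{i=0}^2 I'(P_i)^{m·m_i} ⊆ (⋂_{i=0}^2 I'(P_i)^{m_i})^r holds in R'. That is, I_{P^N}(Z)^{(m)} ⊆ I_{P^N}(Z)^r implies I_{P^2}(Z)^{(m)} ⊆ I_{P^2}(Z)^r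 for the three-point fat point scheme Z = m_0P_0 + m_1P_1 + m_2P_2. -/
/-- The ideal of the `j`-th coordinate point of `P^2`, generated by the two
variables `x_i` with `i ≠ j`. -/
noncomputable def ptIdeal3 (K : Type*) [Field K] (j : Fin 3) :
    Ideal (MvPolynomial (Fin 3) K) :=
  Ideal.span {f | ∃ i : Fin 3, i ≠ j ∧ f = MvPolynomial.X i}

section PointIdeals

open MvPolynomial

variable {K : Type*} [Field K] {N : ℕ} {e : Fin 3 → Fin (N + 1)}

/-- Renaming variables along an injection carries a coordinate point ideal of the plane into
the ideal of the corresponding coordinate point of `P^N`. -/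
theorem map_rename_ptIdeal3_le (he : Function.Injective e) (j : Fin 3) :
    (ptIdeal3 K j).map (rename e : MvPolynomial (Fin 3) K →ₐ[K] _) ≤ ptIdeal K N (e j) := by
  rw [ptIdeal3, Ideal.map_span, Ideal.span_le]
  rintro _ ⟨_, ⟨i, hij, rfl⟩, rfl⟩
  exact Ideal.subset_span ⟨e i, he.ne hij, rename_X e i⟩

/-- Killing the variables outside the range of an injection carries the ideal of a coordinate
point of `P^N` in that range into the corresponding point ideal of the plane. -/
theorem map_killCompl_ptIdeal_le (he : Function.Injective e) (j : Fin 3) :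
    (ptIdeal K N (e j)).map (killCompl he : _ →ₐ[K] MvPolynomial (Fin 3) K) ≤ ptIdeal3 K j := by
  rw [ptIdeal, Ideal.map_span, Ideal.span_le]
  rintro _ ⟨_, ⟨i, hij, rfl⟩, rfl⟩
  by_cases hi : i ∈ Set.range e
  · obtain ⟨k, rfl⟩ := hi
    have hX : killCompl he (X (e k) : MvPolynomial _ K) = X k := by
      rw [← rename_X, killCompl_rename_app]
    exact Ideal.subset_span ⟨k, fun h => hij (congrArg e h), hX⟩
  · have hX : killCompl he (X i : MvPolynomial _ K) = 0 := by
      rw [killCompl, aeval_X, dif_neg hi]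
    rw [SetLike.mem_coe]
    exact hX ▸ Ideal.zero_mem _

theorem rename_mem_ptIdeal_pow (he : Function.Injective e) {j : Fin 3} {n : ℕ}
    {f : MvPolynomial (Fin 3) K} (hf : f ∈ ptIdeal3 K j ^ n) :
    rename e f ∈ ptIdeal K N (e j) ^ n := by
  apply Ideal.pow_right_mono (map_rename_ptIdeal3_le he j) n
  rw [← Ideal.map_pow]
  exact Ideal.mem_map_of_mem _ hf

theorem map_killCompl_ptIdeal_pow_le (he : Function.Injective e) (j : Fin 3) (n : ℕ) :
    (ptIdeal K N (e j) ^ n).map (killCompl he : _ →ₐ[K] MvPolynomial (Fin 3) K) ≤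
      ptIdeal3 K j ^ n := by
  rw [Ideal.map_pow]
  exact Ideal.pow_right_mono (map_killCompl_ptIdeal_le he j) n

end PointIdeals

/-- If `I_{P^N}(Z)^{(m)} ⊆ I_{P^N}(Z)^r` for the fat point scheme
`Z = m_0 P_0 + m_1 P_1 + m_2 P_2` at three coordinate points of `P^N`, then
`I_{P^2}(Z)^{(m)} ⊆ I_{P^2}(Z)^r` holds for the corresponding scheme in `P^2`. -/
theorem containment_descends_to_plane
    (K : Type*) [Field K] (N : ℕ) (hN : 2 ≤ N) (m0 m1 m2 : ℕ)
    (m r : ℕ) (hm : 0 < m) (hr : 0 < r)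
    (h : ptIdeal K N 0 ^ (m * m0) ⊓ ptIdeal K N 1 ^ (m * m1) ⊓ ptIdeal K N 2 ^ (m * m2) ≤
        (ptIdeal K N 0 ^ m0 ⊓ ptIdeal K N 1 ^ m1 ⊓ ptIdeal K N 2 ^ m2) ^ r) :
    ptIdeal3 K 0 ^ (m * m0) ⊓ ptIdeal3 K 1 ^ (m * m1) ⊓ ptIdeal3 K 2 ^ (m * m2) ≤
      (ptIdeal3 K 0 ^ m0 ⊓ ptIdeal3 K 1 ^ m1 ⊓ ptIdeal3 K 2 ^ m2) ^ r := by
  have he : Function.Injective (Fin.castLE (show 3 ≤ N + 1 by omega)) :=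
    Fin.castLE_injective _
  have h0 : (0 : Fin (N + 1)) = Fin.castLE (show 3 ≤ N + 1 by omega) 0 := rfl
  have h1 : (1 : Fin (N + 1)) = Fin.castLE (show 3 ≤ N + 1 by omega) 1 :=
    Fin.ext (Nat.mod_eq_of_lt (show 1 < N + 1 by omega))
  have h2 : (2 : Fin (N + 1)) = Fin.castLE (show 3 ≤ N + 1 by omega) 2 :=
    Fin.ext (Nat.mod_eq_of_lt (show 2 < N + 1 by omega))
  rw [h0, h1, h2] at h
  rintro f ⟨⟨hf0, hf1⟩, hf2⟩
  have hf := Ideal.mem_map_of_mem (MvPolynomial.killCompl he)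
    (h ⟨⟨rename_mem_ptIdeal_pow he hf0, rename_mem_ptIdeal_pow he hf1⟩,
      rename_mem_ptIdeal_pow he hf2⟩)
  rw [MvPolynomial.killCompl_rename_app, Ideal.map_pow] at hf
  refine Ideal.pow_right_mono (le_inf (le_inf ?_ ?_) ?_) r hf
  · exact (Ideal.map_mono (inf_le_left.trans inf_le_left)).trans
      (map_killCompl_ptIdeal_pow_le he 0 m0)
  · exact (Ideal.map_mono (inf_le_left.trans inf_le_right)).trans
      (map_killCompl_ptIdeal_pow_le he 1 m1)
  · exact (Ideal.map_mono inf_le_right).trans (map_killCompl_ptIdeal_pow_le he 2 m2)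
end

section
/- Let Z = m_0P_0 + m_1P_1 + m_2P_2 be the fat point scheme at the three coordinate points of P^2 with max(m_0, m_1) ≤ m_2, and let I'(Z) = I'(P_0)^{m_0} ∩ I'(P_1)^{m_1} ∩ I'(P_2)^{m_2} ⊆ R'. Then the initial degree α(I'(Z)) equals: (a) m_2, if m_2 ≥ m_0 + m_1; (b) (m_0 + m_1 + m_2)/2, if m_2 ≤ m_0 + m_1 and m_0 + m_1 + m_2 is even; (c) (m_0 + m_1 + m_2 + 1)/2, if m_2 ≤ m_0 + m_1 and m_0 + m_1 + m_2 is odd. -/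
/-- `α(I)`: the least degree of a nonzero element of the ideal `I`. -/
noncomputable def alphaDeg {K : Type*} [Field K] {σ : Type*}
    (I : Ideal (MvPolynomial σ K)) : ℕ :=
  sInf {d | ∃ f ∈ I, f ≠ 0 ∧ MvPolynomial.totalDegree f = d}

/-- Every monomial of an element of the `n`-th power of the ideal generated by the variables in `s`
has degree at least `n` in those variables. -/
theorem le_sum_of_mem_span_X_pow {R σ : Type*} [CommRing R] (s : Finset σ) (n : ℕ)
    {f : MvPolynomial σ R}
    (hf : f ∈ Ideal.span (MvPolynomial.X '' (s : Set σ)) ^ n) :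
    ∀ a ∈ f.support, n ≤ ∑ i ∈ s, a i := by
  classical
  induction n generalizing f with
  | zero => simp
  | succ n ih =>
    rw [pow_succ] at hf
    induction hf using Submodule.mul_induction_on' with
    | mem_mul_mem p hp q hq =>
      intro a ha
      obtain ⟨b, hb, c, hc, rfl⟩ := Finset.mem_add.1 (MvPolynomial.support_mul p q ha)
      obtain ⟨i, hi, hci⟩ := MvPolynomial.mem_ideal_span_X_image.1 hq c hc
      have h₁ := ih hp b hb
      have h₂ : c i ≤ ∑ i ∈ s, c i :=
        Finset.single_le_sum (fun _ _ => Nat.zero_le _) (Finset.mem_coe.1 hi)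
      simp only [Finsupp.add_apply, Finset.sum_add_distrib]
      omega
    | add p _ q _ hp hq =>
      intro a ha
      rcases Finset.mem_union.1 (MvPolynomial.support_add ha) with h | h
      · exact hp a h
      · exact hq a h

/-- A monomial of degree at least `n` in the variables in `s` lies in the `n`-th power of the
ideal generated by these variables. -/
theorem monomial_mem_span_X_pow {R σ : Type*} [CommRing R] [Fintype σ] (s : Finset σ)
    (n : ℕ) (a : σ →₀ ℕ) (ha : n ≤ ∑ i ∈ s, a i) :
    MvPolynomial.monomial a (1 : R) ∈ Ideal.span (MvPolynomial.X '' (s : Set σ)) ^ n := by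
  classical
  apply Ideal.pow_le_pow_right ha
  rw [MvPolynomial.monomial_eq, map_one, one_mul, Finsupp.prod_fintype _ _ (by simp),
    ← Finset.prod_mul_prod_compl s, ← Finset.prod_pow_eq_pow_sum]
  exact Ideal.mul_mem_right _ _ (Ideal.prod_mem_prod fun i hi =>
    Ideal.pow_mem_pow (Ideal.subset_span (Set.mem_image_of_mem _ hi)) _)

theorem ptIdeal3_eq_span_X_image (K : Type*) [Field K] (j : Fin 3) :
    ptIdeal3 K j =
      Ideal.span (MvPolynomial.X '' ((Finset.univ.erase j : Finset (Fin 3)) : Set (Fin 3))) := by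
  unfold ptIdeal3
  congr 1
  ext f
  simp [eq_comm]

/-- The initial degree of three fat points is `d` as soon as `d` is the degree of an admissible
exponent vector and a lower bound for the degree of all of them. -/
theorem alphaDeg_fatPoints_eq (K : Type*) [Field K] (m0 m1 m2 d a b c : ℕ)
    (h0 : m0 ≤ b + c) (h1 : m1 ≤ a + c) (h2 : m2 ≤ a + b) (hd : a + b + c = d)
    (hmin : ∀ x y z : ℕ, m0 ≤ y + z → m1 ≤ x + z → m2 ≤ x + y → d ≤ x + y + z) :
    alphaDeg (ptIdeal3 K 0 ^ m0 ⊓ ptIdeal3 K 1 ^ m1 ⊓ ptIdeal3 K 2 ^ m2) = d := by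
  have e0 : (Finset.univ.erase 0 : Finset (Fin 3)) = {1, 2} := by decide
  have e1 : (Finset.univ.erase 1 : Finset (Fin 3)) = {0, 2} := by decide
  have e2 : (Finset.univ.erase 2 : Finset (Fin 3)) = {0, 1} := by decide
  simp only [ptIdeal3_eq_span_X_image, e0, e1, e2]
  refine IsLeast.csInf_eq ⟨?_, ?_⟩
  · refine ⟨MvPolynomial.monomial (Finsupp.equivFunOnFinite.symm ![a, b, c]) 1,
      ⟨⟨?_, ?_⟩, ?_⟩, ?_, ?_⟩
    · exact monomial_mem_span_X_pow _ _ _ (by simpa using h0)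
    · exact monomial_mem_span_X_pow _ _ _ (by simpa using h1)
    · exact monomial_mem_span_X_pow _ _ _ (by simpa using h2)
    · simp
    · rw [MvPolynomial.totalDegree_monomial _ one_ne_zero, Finsupp.sum_fintype _ _ (by simp)]
      simpa [Fin.sum_univ_three] using hd
  · rintro _ ⟨f, ⟨⟨hf0, hf1⟩, hf2⟩, hf, rfl⟩
    obtain ⟨v, hv⟩ := MvPolynomial.support_nonempty.2 hf
    have g0 := le_sum_of_mem_span_X_pow _ _ hf0 v hv
    have g1 := le_sum_of_mem_span_X_pow _ _ hf1 v hv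
    have g2 := le_sum_of_mem_span_X_pow _ _ hf2 v hv
    have hdeg := MvPolynomial.le_totalDegree hv
    rw [Finsupp.sum_fintype _ _ (by simp), Fin.sum_univ_three] at hdeg
    exact (hmin (v 0) (v 1) (v 2) (by simpa using g0) (by simpa using g1)
      (by simpa using g2)).trans hdeg

/-- Initial degree of the ideal of `Z = m_0 P_0 + m_1 P_1 + m_2 P_2` at the three
coordinate points of `P^2` with `max(m_0, m_1) ≤ m_2`:
(a) `m_2` if `m_2 ≥ m_0 + m_1`; (b) `(m_0+m_1+m_2)/2` if `m_2 ≤ m_0+m_1` and the sum is even;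
(c) `(m_0+m_1+m_2+1)/2` if `m_2 ≤ m_0+m_1` and the sum is odd. -/
theorem alpha_three_fat_points_P2
    (K : Type*) [Field K] (m0 m1 m2 : ℕ) (hmax : max m0 m1 ≤ m2) :
    (m0 + m1 ≤ m2 →
      alphaDeg (ptIdeal3 K 0 ^ m0 ⊓ ptIdeal3 K 1 ^ m1 ⊓ ptIdeal3 K 2 ^ m2) = m2) ∧
    (m2 ≤ m0 + m1 → Even (m0 + m1 + m2) →
      2 * alphaDeg (ptIdeal3 K 0 ^ m0 ⊓ ptIdeal3 K 1 ^ m1 ⊓ ptIdeal3 K 2 ^ m2) =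
        m0 + m1 + m2) ∧
    (m2 ≤ m0 + m1 → Odd (m0 + m1 + m2) →
      2 * alphaDeg (ptIdeal3 K 0 ^ m0 ⊓ ptIdeal3 K 1 ^ m1 ⊓ ptIdeal3 K 2 ^ m2) =
        m0 + m1 + m2 + 1) := by
  obtain ⟨h0, h1⟩ := max_le_iff.1 hmax
  refine ⟨fun h => ?_, fun h ⟨s, hs⟩ => ?_, fun h ⟨s, hs⟩ => ?_⟩
  · exact alphaDeg_fatPoints_eq K m0 m1 m2 m2 m1 (m2 - m1) 0
      (by omega) (by omega) (by omega) (by omega) (by omega)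
  · rw [alphaDeg_fatPoints_eq K m0 m1 m2 s (s - m0) (s - m1) (s - m2)
      (by omega) (by omega) (by omega) (by omega) (by omega)]
    omega
  · rw [alphaDeg_fatPoints_eq K m0 m1 m2 (s + 1) (s + 1 - m0) (s + 1 - m1) (s - m2)
      (by omega) (by omega) (by omega) (by omega) (by omega)]
    omega
end

section
/- Let Z = m_0P_0 + m_1P_1 + m_2P_2 be a fat point scheme at three noncollinear points (taken to be the coordinate points) of P^N with m_2 ≥ max(m_0, m_1). If m_0 + m_1 ≤ m_2, then I(Z)^{(m)} = I(Z)^m for all m ∈ ℕ; consequently, if m_2 ≥ 1, ρ(I(Z)) = 1. -/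
theorem exists_nat_split_of_add_eq {m0 m1 m2 p q r x y z s : ℕ} (h : m0 + m1 ≤ m2) (h' : p + q ≤ r)
    (h0 : m0 + p ≤ y + z + s) (h1 : m1 + q ≤ x + z + s) (h2 : x + y + s = m2 + r) :
    ∃ x₁ x₂ y₁ y₂ z₁ z₂ s₁ s₂ : ℕ, x = x₁ + x₂ ∧ y = y₁ + y₂ ∧ z = z₁ + z₂ ∧ s = s₁ + s₂ ∧
      m0 ≤ y₁ + z₁ + s₁ ∧ m1 ≤ x₁ + z₁ + s₁ ∧ m2 ≤ x₁ + y₁ + s₁ ∧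
      p ≤ y₂ + z₂ + s₂ ∧ q ≤ x₂ + z₂ + s₂ ∧ r ≤ x₂ + y₂ + s₂ := by
  suffices ∃ x₁ y₁ z₁ s₁ : ℕ, x₁ ≤ x ∧ y₁ ≤ y ∧ z₁ ≤ z ∧ s₁ ≤ s ∧ x₁ + y₁ + s₁ = m2 ∧
      x₁ + m0 ≤ m2 + z₁ ∧ y₁ + m1 ≤ m2 + z₁ ∧
      x + p + z₁ ≤ x₁ + z + r ∧ y + q + z₁ ≤ y₁ + z + r by
    obtain ⟨x₁, y₁, z₁, s₁, h⟩ := this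
    exact ⟨x₁, x - x₁, y₁, y - y₁, z₁, z - z₁, s₁, s - s₁, by omega⟩
  by_cases hx : m2 + r < x + m0 + p
  · obtain ⟨x₁, hx₁⟩ : ∃ x₁, x₁ = max (m2 - m0) (x - r) := ⟨_, rfl⟩
    exact ⟨x₁, min y (m2 - x₁), x₁ - (m2 - m0), m2 - x₁ - min y (m2 - x₁), by omega⟩
  by_cases hy : m2 + r < y + m1 + q
  · obtain ⟨y₁, hy₁⟩ : ∃ y₁, y₁ = max (m2 - m1) (y - r) := ⟨_, rfl⟩
    exact ⟨min x (m2 - y₁), y₁, y₁ - (m2 - m1), m2 - y₁ - min x (m2 - y₁), by omega⟩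
  obtain ⟨xl, hxl⟩ : ∃ t, t = x - (r - p) := ⟨_, rfl⟩
  obtain ⟨yl, hyl⟩ : ∃ t, t = y - (r - q) := ⟨_, rfl⟩
  obtain ⟨x₁, hx₁⟩ : ∃ t, t = min (min x (m2 - m0)) (m2 - yl) := ⟨_, rfl⟩
  obtain ⟨y₁, hy₁⟩ : ∃ t, t = min (min y (m2 - m1)) (m2 - x₁) := ⟨_, rfl⟩
  exact ⟨x₁, y₁, 0, m2 - x₁ - y₁, by omega⟩

theorem exists_nat_split {m0 m1 m2 p q r x y z s : ℕ} (h : m0 + m1 ≤ m2) (h' : p + q ≤ r)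
    (h0 : m0 + p ≤ y + z + s) (h1 : m1 + q ≤ x + z + s) (h2 : m2 + r ≤ x + y + s) :
    ∃ x₁ x₂ y₁ y₂ z₁ z₂ s₁ s₂ : ℕ, x = x₁ + x₂ ∧ y = y₁ + y₂ ∧ z = z₁ + z₂ ∧ s = s₁ + s₂ ∧
      m0 ≤ y₁ + z₁ + s₁ ∧ m1 ≤ x₁ + z₁ + s₁ ∧ m2 ≤ x₁ + y₁ + s₁ ∧
      p ≤ y₂ + z₂ + s₂ ∧ q ≤ x₂ + z₂ + s₂ ∧ r ≤ x₂ + y₂ + s₂ := by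
  suffices ∃ x' y' s', x' ≤ x ∧ y' ≤ y ∧ s' ≤ s ∧ m0 + p ≤ y' + z + s' ∧ m1 + q ≤ x' + z + s' ∧
      x' + y' + s' = m2 + r by
    obtain ⟨x', y', s', hx, hy, hs, h0', h1', h2'⟩ := this
    obtain ⟨x₁, x₂, y₁, y₂, z₁, z₂, s₁, s₂, H⟩ := exists_nat_split_of_add_eq h h' h0' h1' h2'
    exact ⟨x₁, x - x₁, y₁, y - y₁, z₁, z₂, s₁, s - s₁, by omega⟩
  obtain ⟨x', hx'⟩ : ∃ t, t = min x (max (m2 + r - y - s) (m1 + q - z - s)) := ⟨_, rfl⟩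
  obtain ⟨y', hy'⟩ : ∃ t, t = min y (m2 + r - s - x') := ⟨_, rfl⟩
  exact ⟨x', y', m2 + r - x' - y', by omega⟩

theorem Finsupp.degree_erase_add {σ : Type*} (d : σ →₀ ℕ) (j : σ) :
    (d.erase j).degree + d j = d.degree := by
  conv_rhs => rw [← Finsupp.erase_add_single j d]
  rw [map_add, Finsupp.degree_single]

theorem exists_finsupp_split {σ : Type*} {i j k : σ} (hij : i ≠ j) (hik : i ≠ k) (hjk : j ≠ k)
    {m0 m1 m2 p q r : ℕ} (h : m0 + m1 ≤ m2) (h' : p + q ≤ r) (d : σ →₀ ℕ)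
    (h0 : m0 + p ≤ (d.erase i).degree) (h1 : m1 + q ≤ (d.erase j).degree)
    (h2 : m2 + r ≤ (d.erase k).degree) :
    ∃ b c : σ →₀ ℕ, d = b + c ∧
      m0 ≤ (b.erase i).degree ∧ m1 ≤ (b.erase j).degree ∧ m2 ≤ (b.erase k).degree ∧
      p ≤ (c.erase i).degree ∧ q ≤ (c.erase j).degree ∧ r ≤ (c.erase k).degree := by
  obtain ⟨g, hg⟩ : ∃ g, g = ((d.erase i).erase j).erase k := ⟨_, rfl⟩
  have e (d : σ →₀ ℕ) : d.degree = (((d.erase i).erase j).erase k).degree + d i + d j + d k := by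
    rw [← Finsupp.degree_erase_add d i, ← Finsupp.degree_erase_add (d.erase i) j,
      ← Finsupp.degree_erase_add ((d.erase i).erase j) k]
    simp only [Finsupp.erase_ne hij.symm, Finsupp.erase_ne hik.symm, Finsupp.erase_ne hjk.symm]
    ring
  have hd := e d
  rw [← hg] at hd
  have hdi := Finsupp.degree_erase_add d i
  have hdj := Finsupp.degree_erase_add d j
  have hdk := Finsupp.degree_erase_add d k
  obtain ⟨x₁, x₂, y₁, y₂, z₁, z₂, s₁, s₂, hx, hy, hz, hs, H⟩ :=
    exists_nat_split (x := d i) (y := d j) (z := d k) (s := g.degree) h h'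
      (by omega) (by omega) (by omega)
  obtain ⟨g₁, hle, hg₁⟩ := Finsupp.exists_le_degree_eq g s₁ (by omega)
  obtain ⟨g₂, rfl⟩ := exists_add_of_le hle
  have hg₂ : g₂.degree = s₂ := by rw [map_add] at hs; omega
  have z : ∀ l, l = i ∨ l = j ∨ l = k → g₁ l = 0 ∧ g₂ l = 0 := by
    intro l hl
    have : (g₁ + g₂) l = 0 := by
      rw [hg]
      rcases hl with rfl | rfl | rfl <;> simp [Finsupp.erase_ne, hij, hik, hjk]
    rw [Finsupp.add_apply] at this
    omega
  obtain ⟨b, hb⟩ : ∃ b, b = g₁ + .single i x₁ + .single j y₁ + .single k z₁ := ⟨_, rfl⟩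
  obtain ⟨c, hc⟩ : ∃ c, c = g₂ + .single i x₂ + .single j y₂ + .single k z₂ := ⟨_, rfl⟩
  have hbd : b.degree = s₁ + x₁ + y₁ + z₁ := by simp [hb, hg₁]
  have hcd : c.degree = s₂ + x₂ + y₂ + z₂ := by simp [hc, hg₂]
  have hbi : b i = x₁ := by simp [hb, z, hij, hik]
  have hbj : b j = y₁ := by simp [hb, z, hij.symm, hjk]
  have hbk : b k = z₁ := by simp [hb, z, hik.symm, hjk.symm]
  have hci : c i = x₂ := by simp [hc, z, hij, hik]
  have hcj : c j = y₂ := by simp [hc, z, hij.symm, hjk]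
  have hck : c k = z₂ := by simp [hc, z, hik.symm, hjk.symm]
  have b1 := Finsupp.degree_erase_add b i
  have b2 := Finsupp.degree_erase_add b j
  have b3 := Finsupp.degree_erase_add b k
  have c1 := Finsupp.degree_erase_add c i
  have c2 := Finsupp.degree_erase_add c j
  have c3 := Finsupp.degree_erase_add c k
  refine ⟨b, c, ?_, by omega, by omega, by omega, by omega, by omega, by omega⟩
  ext l
  by_cases hl : l = i ∨ l = j ∨ l = k
  · rw [Finsupp.add_apply]
    rcases hl with rfl | rfl | rfl <;> omega
  · push Not at hl
    have := DFunLike.congr_fun hg l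
    simp only [Finsupp.erase_ne hl.1, Finsupp.erase_ne hl.2.1, Finsupp.erase_ne hl.2.2] at this
    simp [← this, hb, hc, hl.1, hl.2.1, hl.2.2]

section ptIdeal

open MvPolynomial

variable {K : Type*} [Field K] {N : ℕ}

theorem monomial_mem_ptIdeal_pow_s9 {j : Fin (N + 1)} {n : ℕ} {d : Fin (N + 1) →₀ ℕ} (a : K)
    (h : n ≤ (d.erase j).degree) : monomial d a ∈ ptIdeal K N j ^ n := by
  refine Ideal.pow_le_pow_right h ?_
  have key : monomial (d.erase j) (1 : K) ∈ ptIdeal K N j ^ (d.erase j).degree := by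
    rw [monomial_eq, C_1, one_mul, Finsupp.prod, Finsupp.degree_apply,
      ← Finset.prod_pow_eq_pow_sum]
    refine Ideal.prod_mem_prod fun i hi => Ideal.pow_mem_pow ?_ _
    rw [Finsupp.support_erase] at hi
    exact Ideal.subset_span ⟨i, Finset.ne_of_mem_erase hi, rfl⟩
  have hmul : monomial d a = monomial (Finsupp.single j (d j)) a * monomial (d.erase j) 1 := by
    rw [monomial_mul, Finsupp.single_add_erase, mul_one]
  rw [hmul]
  exact Ideal.mul_mem_left _ _ key

theorem mem_ptIdeal_pow_iff {j : Fin (N + 1)} {n : ℕ} {f : MvPolynomial (Fin (N + 1)) K} :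
    f ∈ ptIdeal K N j ^ n ↔ ∀ d ∈ f.support, n ≤ (d.erase j).degree := by
  constructor
  · suffices ptIdeal K N j ^ n ≤ Ideal.span
        ((fun d => monomial d (1 : K)) '' {d | n ≤ (d.erase j).degree}) by
      intro hf d hd
      obtain ⟨e, he, hed⟩ := mem_ideal_span_monomial_image.1 (this hf) d hd
      obtain ⟨c, rfl⟩ := exists_add_of_le hed
      rw [Finsupp.erase_add, map_add]
      exact le_add_right he
    induction n with
    | zero =>
      rw [pow_zero, Ideal.one_eq_top, top_le_iff, Ideal.eq_top_iff_one]
      exact Ideal.subset_span ⟨0, by simp, rfl⟩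
    | succ n ih =>
      rw [pow_succ]
      refine (Ideal.mul_mono_left ih).trans ?_
      rw [ptIdeal, Ideal.span_mul_span', Ideal.span_le]
      rintro _ ⟨_, ⟨d, hd, rfl⟩, _, ⟨i, hi, rfl⟩, rfl⟩
      refine Ideal.subset_span ⟨d + Finsupp.single i 1, ?_, ?_⟩
      · simpa [Finsupp.erase_add, Finsupp.erase_single_ne hi.symm] using hd
      · simp [X, monomial_mul]
  · intro h
    rw [f.as_sum]
    exact Ideal.sum_mem _ fun d hd => monomial_mem_ptIdeal_pow_s9 _ (h d hd)

theorem monomial_mem_inf_ptIdeal_pow {i j k : Fin (N + 1)}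
    (hij : i ≠ j) (hik : i ≠ k) (hjk : j ≠ k) {m0 m1 m2 : ℕ} (hle : m0 + m1 ≤ m2) (m : ℕ)
    (d : Fin (N + 1) →₀ ℕ) (a : K) (h0 : m * m0 ≤ (d.erase i).degree)
    (h1 : m * m1 ≤ (d.erase j).degree) (h2 : m * m2 ≤ (d.erase k).degree) :
    monomial d a ∈ (ptIdeal K N i ^ m0 ⊓ ptIdeal K N j ^ m1 ⊓ ptIdeal K N k ^ m2) ^ m := by
  induction m generalizing d a with
  | zero => simp
  | succ m ih =>
    obtain ⟨b, c, rfl, b0, b1, b2, c0, c1, c2⟩ :=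
      exists_finsupp_split hij hik hjk hle (p := m * m0) (q := m * m1) (r := m * m2)
        (by rw [← mul_add]; exact Nat.mul_le_mul_left m hle) d (by linarith) (by linarith)
        (by linarith)
    rw [pow_succ', ← one_mul a, ← monomial_mul]
    exact Ideal.mul_mem_mul ⟨⟨monomial_mem_ptIdeal_pow_s9 _ b0, monomial_mem_ptIdeal_pow_s9 _ b1⟩,
      monomial_mem_ptIdeal_pow_s9 _ b2⟩ (ih c a c0 c1 c2)

theorem inf_ptIdeal_pow_eq_s9 {i j k : Fin (N + 1)}
    (hij : i ≠ j) (hik : i ≠ k) (hjk : j ≠ k) {m0 m1 m2 : ℕ} (hle : m0 + m1 ≤ m2) (m : ℕ) :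
    ptIdeal K N i ^ (m * m0) ⊓ ptIdeal K N j ^ (m * m1) ⊓ ptIdeal K N k ^ (m * m2) =
      (ptIdeal K N i ^ m0 ⊓ ptIdeal K N j ^ m1 ⊓ ptIdeal K N k ^ m2) ^ m := by
  apply le_antisymm
  · rintro f ⟨⟨h0, h1⟩, h2⟩
    rw [SetLike.mem_coe, mem_ptIdeal_pow_iff] at h0 h1 h2
    rw [f.as_sum]
    exact Ideal.sum_mem _ fun d hd => monomial_mem_inf_ptIdeal_pow hij hik hjk hle m d _
      (h0 d hd) (h1 d hd) (h2 d hd)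
  · simp only [mul_comm m, pow_mul]
    exact le_inf (le_inf (Ideal.pow_right_mono (inf_le_left.trans inf_le_left) m)
      (Ideal.pow_right_mono (inf_le_left.trans inf_le_right) m))
      (Ideal.pow_right_mono inf_le_right m)

theorem not_inf_ptIdeal_pow_le {i j k : Fin (N + 1)}
    (hij : i ≠ j) (hik : i ≠ k) (hjk : j ≠ k) {m0 m1 m2 : ℕ} (hle : m0 + m1 ≤ m2)
    (hpos : 1 ≤ m2) (m : ℕ) :
    ¬ ptIdeal K N i ^ (m * m0) ⊓ ptIdeal K N j ^ (m * m1) ⊓ ptIdeal K N k ^ (m * m2) ≤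
      (ptIdeal K N i ^ m0 ⊓ ptIdeal K N j ^ m1 ⊓ ptIdeal K N k ^ m2) ^ (m + 1) := by
  intro H
  obtain ⟨n, hn⟩ : ∃ n, n = m * m2 := ⟨_, rfl⟩
  obtain ⟨d, hd⟩ : ∃ d : Fin (N + 1) →₀ ℕ, d = .single i n + .single k n := ⟨_, rfl⟩
  have e0 : (d.erase i).degree = n := by
    simp [hd, Finsupp.erase_add, Finsupp.erase_single_ne hik]
  have e1 : (d.erase j).degree = n + n := by
    simp [hd, Finsupp.erase_add, Finsupp.erase_single_ne hij.symm, Finsupp.erase_single_ne hjk]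
  have e2 : (d.erase k).degree = n := by
    simp [hd, Finsupp.erase_add, Finsupp.erase_single_ne hik.symm]
  have i0 : m * m0 ≤ m * m2 := Nat.mul_le_mul_left m (by omega)
  have i1 : m * m1 ≤ m * m2 := Nat.mul_le_mul_left m (by omega)
  have hmem : monomial d (1 : K) ∈
      ptIdeal K N i ^ (m * m0) ⊓ ptIdeal K N j ^ (m * m1) ⊓ ptIdeal K N k ^ (m * m2) :=
    ⟨⟨monomial_mem_ptIdeal_pow_s9 _ (by omega), monomial_mem_ptIdeal_pow_s9 _ (by omega)⟩,
      monomial_mem_ptIdeal_pow_s9 _ (by omega)⟩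
  have h := H hmem
  rw [← inf_ptIdeal_pow_eq_s9 hij hik hjk hle] at h
  have h' := mem_ptIdeal_pow_iff.1 h.2 d (by simp [mem_support_iff])
  rw [e2, add_mul] at h'
  omega

end ptIdeal

theorem resurgence_eq_one {R : Type*} [CommRing R] {I : Ideal R} {symb : ℕ → Ideal R}
    (h : ∀ m, symb m = I ^ m) (hlt : ∀ m, ¬ symb m ≤ I ^ (m + 1)) : resurgence I symb = 1 := by
  refine csSup_eq_of_forall_le_of_forall_lt_exists_gt
    ⟨_, 1, 2, one_pos, two_pos, hlt 1, rfl⟩ ?_ ?_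
  · rintro _ ⟨m, r, -, hr, hmr, rfl⟩
    rw [div_le_one (by exact_mod_cast hr)]
    by_contra! hc
    refine hmr ?_
    rw [h]
    exact Ideal.pow_le_pow_right (by exact_mod_cast hc.le)
  · intro w hw
    obtain ⟨n, hn⟩ := exists_nat_one_div_lt (sub_pos.2 hw)
    refine ⟨_, ⟨n + 1, n + 2, by omega, by omega, hlt (n + 1), rfl⟩, ?_⟩
    have h1 : (1 : ℝ) / ((n : ℝ) + 2) ≤ 1 / ((n : ℝ) + 1) := by gcongr; norm_num
    have h2 : ((n + 1 : ℕ) : ℝ) / ((n + 2 : ℕ) : ℝ) = 1 - 1 / ((n : ℝ) + 2) := by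
      push_cast
      field_simp
      ring
    rw [h2]
    linarith

/-- For `Z = m_0 P_0 + m_1 P_1 + m_2 P_2` at three noncollinear (coordinate) points of `P^N`
with `m_2 ≥ max(m_0, m_1)` and `m_0 + m_1 ≤ m_2`, one has `I(Z)^{(m)} = I(Z)^m` for all
`m`, and consequently (if `m_2 ≥ 1`) `ρ(I(Z)) = 1`. -/
theorem three_points_small_case_symbolic_eq_ordinary
    (K : Type*) [Field K] (N : ℕ) (hN : 2 ≤ N) (m0 m1 m2 : ℕ)
    (hmax : max m0 m1 ≤ m2) (hle : m0 + m1 ≤ m2) :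
    (∀ m : ℕ,
      ptIdeal K N 0 ^ (m * m0) ⊓ ptIdeal K N 1 ^ (m * m1) ⊓ ptIdeal K N 2 ^ (m * m2) =
        (ptIdeal K N 0 ^ m0 ⊓ ptIdeal K N 1 ^ m1 ⊓ ptIdeal K N 2 ^ m2) ^ m) ∧
    (1 ≤ m2 →
      resurgence (ptIdeal K N 0 ^ m0 ⊓ ptIdeal K N 1 ^ m1 ⊓ ptIdeal K N 2 ^ m2)
        (fun m =>
          ptIdeal K N 0 ^ (m * m0) ⊓ ptIdeal K N 1 ^ (m * m1) ⊓ ptIdeal K N 2 ^ (m * m2)) = 1) := by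
  have h01 : (0 : Fin (N + 1)) ≠ 1 := by
    simp [Fin.ext_iff, Nat.mod_eq_of_lt (show 1 < N + 1 by omega)]
  have h02 : (0 : Fin (N + 1)) ≠ 2 := by
    simp [Fin.ext_iff, Nat.mod_eq_of_lt (show 2 < N + 1 by omega)]
  have h12 : (1 : Fin (N + 1)) ≠ 2 := by
    simp [Fin.ext_iff, Nat.mod_eq_of_lt (show 2 < N + 1 by omega),
      Nat.mod_eq_of_lt (show 1 < N + 1 by omega)]
  exact ⟨inf_ptIdeal_pow_eq_s9 h01 h02 h12 hle, fun hpos =>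
    resurgence_eq_one (inf_ptIdeal_pow_eq_s9 h01 h02 h12 hle)
      (not_inf_ptIdeal_pow_le h01 h02 h12 hle hpos)⟩
end

section
/- Let m_0, m_1, m_2 be nonnegative integers with m_2 ≥ max(m_0, m_1) and m_0 + m_1 > m_2. Then for the coordinate points P_0, P_1, P_2 of P^N: I(P_0)^{m_0} ∩ I(P_1)^{m_1} ∩ I(P_2)^{m_2} = (I(P_0)^{s} ∩ I(P_1)^{s} ∩ I(P_2)^{s}) · (I(P_0)^{m_2−m_1} ∩ I(P_2)^{m_2−m_1}) · (I(P_1)^{m_2−m_0} ∩ I(P_2)^{m_2−m_0}), where s = m_0 + m_1 − m_2; i.e. I(Z) = I((m_0+m_1−m_2)(P_0+P_1+P_2)) · I((m_2−m_1)(P_0+P_2)) · I((m_2−m_0)(P_1+P_2)). -/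
/-- A polynomial in the `m`-th power of a coordinate point ideal only involves monomials
whose degree in the variables other than `x_j` is at least `m`. -/
theorem add_apply_le_sum_of_mem_ptIdeal_pow {K : Type*} [Field K] {N : ℕ} {j : Fin (N + 1)}
    {m : ℕ} {f : MvPolynomial (Fin (N + 1)) K} (hf : f ∈ ptIdeal K N j ^ m)
    {a : Fin (N + 1) →₀ ℕ} (ha : a ∈ f.support) : m + a j ≤ ∑ i, a i := by
  classical
  induction m generalizing f a with
  | zero =>
    rw [zero_add]
    exact Finset.single_le_sum (f := a) (fun _ _ => Nat.zero_le _) (Finset.mem_univ j)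
  | succ m ih =>
    rw [pow_succ] at hf
    induction hf using Submodule.mul_induction_on' generalizing a with
    | mem_mul_mem g hg h hh =>
      obtain ⟨b, hb, c, hc, rfl⟩ := Finset.mem_add.mp (MvPolynomial.support_mul g h ha)
      have hspan : ptIdeal K N j = Ideal.span (MvPolynomial.X '' {i | i ≠ j}) := by
        unfold ptIdeal
        congr 1
        ext f
        simp [eq_comm]
      rw [hspan, MvPolynomial.mem_ideal_span_X_image] at hh
      obtain ⟨i, hij, hci⟩ := hh c hc
      have hpair : c i + c j ≤ ∑ k, c k := by
        rw [← Finset.sum_pair (f := c) hij]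
        exact Finset.sum_le_sum_of_subset (Finset.subset_univ _)
      have hm := ih hg hb
      simp only [Finsupp.add_apply, Finset.sum_add_distrib]
      omega
    | add g _ h _ hg hh =>
      rcases Finset.mem_union.mp (MvPolynomial.support_add ha) with h' | h'
      · exact hg h'
      · exact hh h'

theorem X_mem_ptIdeal (K : Type*) [Field K] (N : ℕ) {i j : Fin (N + 1)} (h : i ≠ j) :
    MvPolynomial.X i ∈ ptIdeal K N j :=
  Ideal.subset_span ⟨i, h, rfl⟩

/-- Splitting of an exponent vector `(x, y, z, r)`, where `r` is the total degree in the
variables `x_3, …, x_N`, into three vectors lying in the three factor ideals. -/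
theorem exists_exponent_splitting {s p q x y z r : ℕ} (h0 : s + p ≤ y + z + r)
    (h1 : s + q ≤ x + z + r) (h2 : s + p + q ≤ x + y + r) :
    ∃ x₁ x₂ x₃ y₁ y₂ y₃ z₁ z₂ z₃ r₁ r₂ r₃ : ℕ,
      x = x₁ + x₂ + x₃ ∧ y = y₁ + y₂ + y₃ ∧ z = z₁ + z₂ + z₃ ∧ r = r₁ + r₂ + r₃ ∧
      s ≤ y₁ + z₁ + r₁ ∧ s ≤ x₁ + z₁ + r₁ ∧ s ≤ x₁ + y₁ + r₁ ∧
      p ≤ y₂ + z₂ + r₂ ∧ p ≤ x₂ + y₂ + r₂ ∧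
      q ≤ x₃ + z₃ + r₃ ∧ q ≤ x₃ + y₃ + r₃ := by
  rcases le_or_gt p y with hy | hy <;> rcases le_or_gt q x with hx | hx
  · exact ⟨x - q, 0, q, y - p, p, 0, z, 0, 0, r, 0, 0, by omega⟩
  · rcases le_or_gt (q - x) r with hr | hr
    · exact ⟨0, 0, x, y - p, p, 0, z, 0, 0, r - (q - x), 0, q - x, by omega⟩
    · exact ⟨0, 0, x, y - p - (q - x - r), p, q - x - r, z - (q - x - r), 0, q - x - r,
        0, 0, r, by omega⟩
  · rcases le_or_gt (p - y) r with hr | hr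
    · exact ⟨x - q, 0, q, 0, y, 0, z, 0, 0, r - (p - y), p - y, 0, by omega⟩
    · exact ⟨x - q - (p - y - r), p - y - r, q, 0, y, 0, z - (p - y - r), p - y - r, 0,
        0, r, 0, by omega⟩
  · rcases le_or_gt (p - y) r with hr | hr
    · exact ⟨0, 0, x, 0, y, 0, z, 0, 0, r - (p - y) - (q - x), p - y, q - x, by omega⟩
    · exact ⟨x - q - (p - y - r), p - y - r, q, 0, y, 0, z - (p - y - r), p - y - r, 0,
        0, r, 0, by omega⟩

theorem Ideal.mul_pow_mul_pow_mul_pow_le {R : Type*} [CommRing R] {A B C D I : Ideal R}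
    (hB : B ≤ I) (hC : C ≤ I) (hD : D ≤ I) {y z r m : ℕ} (h : m ≤ y + z + r) :
    A * (B ^ y * C ^ z * D ^ r) ≤ I ^ m := by
  refine Ideal.mul_le_right.trans (le_trans ?_ (Ideal.pow_le_pow_right h))
  rw [pow_add, pow_add]
  exact Ideal.mul_mono (Ideal.mul_mono (Ideal.pow_right_mono hB _) (Ideal.pow_right_mono hC _))
    (Ideal.pow_right_mono hD _)

theorem Ideal.mul_pow_inf_le_splitting {R : Type*} [CommRing R] (I₀ I₁ I₂ : Ideal R)
    {s p q x y z r : ℕ} (h0 : s + p ≤ y + z + r)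
    (h1 : s + q ≤ x + z + r) (h2 : s + p + q ≤ x + y + r) :
    (I₁ ⊓ I₂) ^ x * (I₀ ⊓ I₂) ^ y * (I₀ ⊓ I₁) ^ z * (I₀ ⊓ I₁ ⊓ I₂) ^ r ≤
      (I₀ ^ s ⊓ I₁ ^ s ⊓ I₂ ^ s) * ((I₀ ^ p ⊓ I₂ ^ p) * (I₁ ^ q ⊓ I₂ ^ q)) := by
  obtain ⟨x₁, x₂, x₃, y₁, y₂, y₃, z₁, z₂, z₃, r₁, r₂, r₃, rfl, rfl, rfl, rfl,
    b0, b1, b2, c0, c2, d1, d2⟩ := exists_exponent_splitting h0 h1 h2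
  set A := I₁ ⊓ I₂
  set B := I₀ ⊓ I₂
  set C := I₀ ⊓ I₁
  set D := I₀ ⊓ I₁ ⊓ I₂
  have A1 : A ≤ I₁ := inf_le_left
  have A2 : A ≤ I₂ := inf_le_right
  have B0 : B ≤ I₀ := inf_le_left
  have B2 : B ≤ I₂ := inf_le_right
  have C0 : C ≤ I₀ := inf_le_left
  have C1 : C ≤ I₁ := inf_le_right
  have D0 : D ≤ I₀ := inf_le_left.trans inf_le_left
  have D1 : D ≤ I₁ := inf_le_left.trans inf_le_right
  have D2 : D ≤ I₂ := inf_le_right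
  have le0 {x y z r m : ℕ} (h : m ≤ y + z + r) : A ^ x * B ^ y * C ^ z * D ^ r ≤ I₀ ^ m :=
    le_of_eq_of_le (by ring) (Ideal.mul_pow_mul_pow_mul_pow_le (A := A ^ x) B0 C0 D0 h)
  have le1 {x y z r m : ℕ} (h : m ≤ x + z + r) : A ^ x * B ^ y * C ^ z * D ^ r ≤ I₁ ^ m :=
    le_of_eq_of_le (by ring) (Ideal.mul_pow_mul_pow_mul_pow_le (A := B ^ y) A1 C1 D1 h)
  have le2 {x y z r m : ℕ} (h : m ≤ x + y + r) : A ^ x * B ^ y * C ^ z * D ^ r ≤ I₂ ^ m :=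
    le_of_eq_of_le (by ring) (Ideal.mul_pow_mul_pow_mul_pow_le (A := C ^ z) A2 B2 D2 h)
  calc
    _ = (A ^ x₁ * B ^ y₁ * C ^ z₁ * D ^ r₁) * ((A ^ x₂ * B ^ y₂ * C ^ z₂ * D ^ r₂) *
        (A ^ x₃ * B ^ y₃ * C ^ z₃ * D ^ r₃)) := by ring
    _ ≤ _ := Ideal.mul_mono (le_inf (le_inf (le0 b0) (le1 b1)) (le2 b2))
        (Ideal.mul_mono (le_inf (le0 c0) (le2 c2)) (le_inf (le1 d1) (le2 d2)))

theorem Ideal.splitting_le {R : Type*} [CommRing R] (I₀ I₁ I₂ : Ideal R) (s p q : ℕ) :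
    (I₀ ^ s ⊓ I₁ ^ s ⊓ I₂ ^ s) * ((I₀ ^ p ⊓ I₂ ^ p) * (I₁ ^ q ⊓ I₂ ^ q)) ≤
      I₀ ^ (s + p) ⊓ I₁ ^ (s + q) ⊓ I₂ ^ (s + p + q) := by
  refine le_inf (le_inf ?_ ?_) ?_
  · rw [pow_add]
    exact Ideal.mul_mono (inf_le_left.trans inf_le_left) (Ideal.mul_le_left.trans inf_le_left)
  · rw [pow_add]
    exact Ideal.mul_mono (inf_le_left.trans inf_le_right) (Ideal.mul_le_right.trans inf_le_left)
  · rw [add_assoc, pow_add, pow_add]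
    exact Ideal.mul_mono inf_le_right (Ideal.mul_mono inf_le_right inf_le_right)

theorem monomial_mem_mul_pow_inf_ptIdeal (K : Type*) [Field K] (n : ℕ)
    (a : Fin (n + 2 + 1) →₀ ℕ) (c : K) :
    MvPolynomial.monomial a c ∈
      (ptIdeal K (n + 2) 1 ⊓ ptIdeal K (n + 2) 2) ^ a 0 *
        (ptIdeal K (n + 2) 0 ⊓ ptIdeal K (n + 2) 2) ^ a 1 *
        (ptIdeal K (n + 2) 0 ⊓ ptIdeal K (n + 2) 1) ^ a 2 *
        (ptIdeal K (n + 2) 0 ⊓ ptIdeal K (n + 2) 1 ⊓ ptIdeal K (n + 2) 2) ^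
          (∑ i : Fin n, a i.succ.succ.succ) := by
  rw [MvPolynomial.monomial_eq, Finsupp.prod_fintype _ _ (fun _ => pow_zero _)]
  refine Ideal.mul_mem_left _ _ ?_
  rw [Fin.prod_univ_succ, Fin.prod_univ_succ, Fin.prod_univ_succ, ← mul_assoc, ← mul_assoc,
    ← Finset.prod_pow_eq_pow_sum]
  have h2 : (2 : Fin (n + 2 + 1)) = Fin.succ (Fin.succ 0) := rfl
  have h1 : (1 : Fin (n + 2 + 1)) = Fin.succ 0 := rfl
  rw [h2, h1]
  refine Ideal.mul_mem_mul (Ideal.mul_mem_mul (Ideal.mul_mem_mul ?_ ?_) ?_)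
    (Ideal.prod_mem_prod fun i _ => ?_)
  all_goals
    refine Ideal.pow_mem_pow ?_ _
    simp only [Submodule.mem_inf]
    repeat' apply And.intro
    all_goals exact X_mem_ptIdeal K _ (by
      simp only [ne_eq, Fin.ext_iff, Fin.val_succ, Fin.val_zero]; omega)

/-- Splitting of `I(Z)` for `Z = m_0 P_0 + m_1 P_1 + m_2 P_2` at the three coordinate
points of `P^N`, when `max(m_0, m_1) ≤ m_2 < m_0 + m_1`: with `s = m_0 + m_1 − m_2`,
`I(Z) = I(s(P_0+P_1+P_2)) · I((m_2−m_1)(P_0+P_2)) · I((m_2−m_0)(P_1+P_2))`. -/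
theorem three_points_splitting_large_case
    (K : Type*) [Field K] (N : ℕ) (hN : 2 ≤ N) (m0 m1 m2 : ℕ)
    (hmax : max m0 m1 ≤ m2) (hgt : m2 < m0 + m1) :
    ptIdeal K N 0 ^ m0 ⊓ ptIdeal K N 1 ^ m1 ⊓ ptIdeal K N 2 ^ m2 =
      (ptIdeal K N 0 ^ (m0 + m1 - m2) ⊓ ptIdeal K N 1 ^ (m0 + m1 - m2) ⊓
          ptIdeal K N 2 ^ (m0 + m1 - m2)) *
        ((ptIdeal K N 0 ^ (m2 - m1) ⊓ ptIdeal K N 2 ^ (m2 - m1)) *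
          (ptIdeal K N 1 ^ (m2 - m0) ⊓ ptIdeal K N 2 ^ (m2 - m0))) := by
  obtain ⟨n, rfl⟩ := Nat.exists_eq_add_of_le' hN
  obtain ⟨h0, h1⟩ := max_le_iff.mp hmax
  apply le_antisymm
  · rintro f ⟨⟨hf0, hf1⟩, hf2⟩
    rw [f.as_sum]
    refine Ideal.sum_mem _ fun a ha => ?_
    have w0 := add_apply_le_sum_of_mem_ptIdeal_pow hf0 ha
    have w1 := add_apply_le_sum_of_mem_ptIdeal_pow hf1 ha
    have w2 := add_apply_le_sum_of_mem_ptIdeal_pow hf2 ha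
    have hsum : ∑ i, a i = a 0 + (a 1 + (a 2 + ∑ i : Fin n, a i.succ.succ.succ)) := by
      rw [Fin.sum_univ_succ, Fin.sum_univ_succ, Fin.sum_univ_succ]
      rfl
    exact Ideal.mul_pow_inf_le_splitting _ _ _ (by omega) (by omega) (by omega)
      (monomial_mem_mul_pow_inf_ptIdeal K n a _)
  · convert Ideal.splitting_le (ptIdeal K (n + 2) 0) (ptIdeal K (n + 2) 1)
      (ptIdeal K (n + 2) 2) (m0 + m1 - m2) (m2 - m1) (m2 - m0) using 4 <;> omega
end

section
/- Let P_0, P_1, P_2 be the coordinate points of P^N, and set J = I(P_0) ∩ I(P_1) ∩ I(P_2) and J₂ = I(P_0)^2 ∩ I(P_1)^2 ∩ I(P_2)^2. Then for all q ∈ ℕ and r ∈ {0,1}: I(P_0)^{2q+r} ∩ I(P_1)^{2q+r} ∩ I(P_2)^{2q+r} = J₂^q · J^r, i.e. I((2q+r)(P_0+P_1+P_2)) = I(2(P_0+P_1+P_2))^q · I(P_0+P_1+P_2)^r. -/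
theorem Finsupp.sum_lt_degree_iff {σ : Type*} [Fintype σ] [DecidableEq σ] (A : Finset σ)
    (s : σ →₀ ℕ) : ∑ i ∈ A, s i < s.degree ↔ ∃ i, i ∉ A ∧ s i ≠ 0 := by
  rw [Finsupp.degree_eq_sum, ← Finset.sum_add_sum_compl A (fun i => s i), lt_add_iff_pos_right,
    pos_iff_ne_zero, Ne, Finset.sum_eq_zero_iff]
  simp

theorem Finsupp.exists_eq_single_add {σ : Type*} {s : σ →₀ ℕ} {i : σ} {n : ℕ} (h : n ≤ s i) :
    ∃ u, s = Finsupp.single i n + u :=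
  le_iff_exists_add.mp (Finsupp.single_le_iff.mpr h)

/-- A monomial vanishing to order `m + 2` at three coordinate points, and not involving the
variable `c`, splits off a factor vanishing to order `2` at each of them. -/
theorem exists_add_of_apply_eq_zero {σ : Type*} [Fintype σ] {a b c : σ} (hab : a ≠ b)
    (hac : a ≠ c) (hbc : b ≠ c) {m : ℕ} {s : σ →₀ ℕ} (ha : m + 2 + s a ≤ s.degree)
    (hb : m + 2 + s b ≤ s.degree) (hc : s c = 0) :
    ∃ t u : σ →₀ ℕ, s = t + u ∧
      (2 + t a ≤ t.degree ∧ 2 + t b ≤ t.degree ∧ 2 + t c ≤ t.degree) ∧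
      m + u a ≤ u.degree ∧ m + u b ≤ u.degree ∧ m + u c ≤ u.degree := by
  classical
  have key (s : σ →₀ ℕ) (h : s a + s b + s c < s.degree) :
      ∃ i u, i ≠ a ∧ i ≠ b ∧ i ≠ c ∧ s = Finsupp.single i 1 + u := by
    obtain ⟨i, hi, hs⟩ := (Finsupp.sum_lt_degree_iff {a, b, c} s).mp (by
      rw [Finset.sum_insert (by simp [hab, hac]), Finset.sum_pair hbc]; omega)
    obtain ⟨u, hu⟩ := Finsupp.exists_eq_single_add (Nat.one_le_iff_ne_zero.mpr hs)
    simp only [Finset.mem_insert, Finset.mem_singleton, not_or] at hi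
    exact ⟨i, u, hi.1, hi.2.1, hi.2.2, hu⟩
  have pair (n : ℕ) (s : σ →₀ ℕ) (h : n ≤ s a) (h' : n ≤ s b) :
      ∃ u, s = Finsupp.single a n + Finsupp.single b n + u := by
    obtain ⟨u, rfl⟩ := Finsupp.exists_eq_single_add h
    obtain ⟨v, rfl⟩ := Finsupp.exists_eq_single_add (s := u) (i := b) (n := n) (by
      simpa [hab] using h')
    exact ⟨v, (add_assoc _ _ _).symm⟩
  have hle : s a + s b + s c ≤ s.degree := by
    rw [Finsupp.degree_eq_sum, add_assoc, ← Finset.sum_pair (f := fun i => s i) hbc,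
      ← Finset.sum_insert (f := fun i => s i) (a := a) (by simp [hab, hac])]
    exact Finset.sum_le_sum_of_subset (Finset.subset_univ _)
  by_cases hd : s a + s b + s c < s.degree
  · obtain ⟨i, u, hia, hib, hic, rfl⟩ := key s hd
    simp [hia, hib, hic] at ha hb hc hd hle
    by_cases hd' : u a + u b + u c < u.degree
    · obtain ⟨j, v, hja, hjb, hjc, rfl⟩ := key u hd'
      simp [hja, hjb, hjc] at ha hb hc hd'
      refine ⟨Finsupp.single i 1 + Finsupp.single j 1, v, (add_assoc _ _ _).symm, ?_⟩
      simp [hia, hib, hic, hja, hjb, hjc]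
      omega
    · obtain ⟨v, rfl⟩ := pair 1 u (by omega) (by omega)
      simp [hab, hab.symm, hac, hbc] at ha hb hc hd'
      refine ⟨Finsupp.single i 1 + (Finsupp.single a 1 + Finsupp.single b 1), v,
        (add_assoc _ _ _).symm, ?_⟩
      simp [hia, hib, hic, hab, hab.symm, hac, hbc]
      omega
  · obtain ⟨v, rfl⟩ := pair 2 s (by omega) (by omega)
    simp [hab, hab.symm, hac, hbc] at ha hb hc hd
    refine ⟨Finsupp.single a 2 + Finsupp.single b 2, v, rfl, ?_⟩
    simp [hab, hab.symm, hac, hbc]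
    omega

/-- A monomial vanishing to order `m + 2` at three coordinate points splits off a factor
vanishing to order `2` at each of them. -/
theorem exists_add_of_add_two_le_degree {σ : Type*} [Fintype σ] {a b c : σ} (hab : a ≠ b)
    (hac : a ≠ c) (hbc : b ≠ c) {m : ℕ} {s : σ →₀ ℕ} (ha : m + 2 + s a ≤ s.degree)
    (hb : m + 2 + s b ≤ s.degree) (hc : m + 2 + s c ≤ s.degree) :
    ∃ t u : σ →₀ ℕ, s = t + u ∧
      (2 + t a ≤ t.degree ∧ 2 + t b ≤ t.degree ∧ 2 + t c ≤ t.degree) ∧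
      m + u a ≤ u.degree ∧ m + u b ≤ u.degree ∧ m + u c ≤ u.degree := by
  by_cases hc0 : s c = 0
  · exact exists_add_of_apply_eq_zero hab hac hbc ha hb hc0
  by_cases hb0 : s b = 0
  · obtain ⟨t, u, h, ht, hu⟩ := exists_add_of_apply_eq_zero hac hab hbc.symm ha hc hb0
    exact ⟨t, u, h, by tauto, by tauto⟩
  by_cases ha0 : s a = 0
  · obtain ⟨t, u, h, ht, hu⟩ := exists_add_of_apply_eq_zero hbc hab.symm hac.symm hb hc ha0
    exact ⟨t, u, h, by tauto, by tauto⟩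
  obtain ⟨u, rfl⟩ := Finsupp.exists_eq_single_add (Nat.one_le_iff_ne_zero.mpr ha0)
  simp [hab, hac] at hb0 hc0
  obtain ⟨v, rfl⟩ := Finsupp.exists_eq_single_add (Nat.one_le_iff_ne_zero.mpr hb0)
  simp [hbc] at hc0
  obtain ⟨w, rfl⟩ := Finsupp.exists_eq_single_add (Nat.one_le_iff_ne_zero.mpr hc0)
  refine ⟨Finsupp.single a 1 + (Finsupp.single b 1 + Finsupp.single c 1), w,
    by simp only [add_assoc], ?_⟩
  simp [hab, hab.symm, hac, hac.symm, hbc, hbc.symm] at ha hb hc ⊢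
  omega

theorem mem_ptIdeal_iff {K : Type*} [Field K] {N : ℕ} {j : Fin (N + 1)}
    {f : MvPolynomial (Fin (N + 1)) K} :
    f ∈ ptIdeal K N j ↔ ∀ s ∈ f.support, 1 + s j ≤ s.degree := by
  have h : {f | ∃ i : Fin (N + 1), i ≠ j ∧ f = MvPolynomial.X i} =
      (MvPolynomial.X '' {i | i ≠ j} : Set (MvPolynomial (Fin (N + 1)) K)) := by
    ext f
    simp [eq_comm]
  rw [ptIdeal, h, MvPolynomial.mem_ideal_span_X_image]
  refine forall₂_congr fun s _ => ?_
  simpa [Nat.add_comm 1, Nat.succ_le_iff] using (Finsupp.sum_lt_degree_iff {j} s).symm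

theorem add_apply_le_degree_of_mem_ptIdeal_pow {K : Type*} [Field K] {N : ℕ} {j : Fin (N + 1)}
    {m : ℕ} {f : MvPolynomial (Fin (N + 1)) K} (hf : f ∈ ptIdeal K N j ^ m) :
    ∀ s ∈ f.support, m + s j ≤ s.degree := by
  classical
  induction m generalizing f with
  | zero => exact fun s _ => by simpa using Finsupp.le_degree j s
  | succ m ih =>
    rw [pow_succ] at hf
    induction hf using Submodule.mul_induction_on' with
    | mem_mul_mem g hg h hh =>
      intro s hs
      obtain ⟨t, ht, u, hu, rfl⟩ := Finset.mem_add.mp (MvPolynomial.support_mul g h hs)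
      have h₁ := ih hg t ht
      have h₂ := mem_ptIdeal_iff.mp hh u hu
      simp only [Finsupp.add_apply, map_add]
      omega
    | add g _ h _ hg hh =>
      intro s hs
      rcases Finset.mem_union.mp (MvPolynomial.support_add hs) with h | h
      exacts [hg s h, hh s h]

theorem monomial_mem_ptIdeal_pow_s12 {K : Type*} [Field K] {N : ℕ} {j : Fin (N + 1)} {m : ℕ}
    {s : Fin (N + 1) →₀ ℕ} (hs : m + s j ≤ s.degree) :
    MvPolynomial.monomial s (1 : K) ∈ ptIdeal K N j ^ m := by
  induction m generalizing s with
  | zero => simp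
  | succ m ih =>
    obtain ⟨i, hi, hsi⟩ := (Finsupp.sum_lt_degree_iff {j} s).mp (by
      rw [Finset.sum_singleton]; omega)
    rw [Finset.mem_singleton] at hi
    obtain ⟨u, rfl⟩ := Finsupp.exists_eq_single_add (Nat.one_le_iff_ne_zero.mpr hsi)
    simp [hi] at hs
    rw [← one_mul (1 : K), ← MvPolynomial.monomial_mul, pow_succ']
    exact Ideal.mul_mem_mul (Ideal.subset_span ⟨i, hi, rfl⟩) (ih (by omega))

theorem monomial_mem_inf_ptIdeal_pow_mul {K : Type*} [Field K] {N : ℕ} {a b c : Fin (N + 1)}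
    (hab : a ≠ b) (hac : a ≠ c) (hbc : b ≠ c) {q r : ℕ} (hr : r < 2) {s : Fin (N + 1) →₀ ℕ}
    (ha : 2 * q + r + s a ≤ s.degree) (hb : 2 * q + r + s b ≤ s.degree)
    (hc : 2 * q + r + s c ≤ s.degree) :
    MvPolynomial.monomial s (1 : K) ∈
      (ptIdeal K N a ^ 2 ⊓ ptIdeal K N b ^ 2 ⊓ ptIdeal K N c ^ 2) ^ q *
        (ptIdeal K N a ⊓ ptIdeal K N b ⊓ ptIdeal K N c) ^ r := by
  induction q generalizing s with
  | zero =>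
    interval_cases r
    · simp
    · have h (j : Fin (N + 1)) (hj : 1 + s j ≤ s.degree) :
          MvPolynomial.monomial s (1 : K) ∈ ptIdeal K N j := by
        simpa using monomial_mem_ptIdeal_pow_s12 (K := K) hj
      simpa using ⟨⟨h a (by omega), h b (by omega)⟩, h c (by omega)⟩
  | succ q ih =>
    obtain ⟨t, u, rfl, ⟨hta, htb, htc⟩, hua, hub, huc⟩ :=
      exists_add_of_add_two_le_degree hab hac hbc (m := 2 * q + r) (s := s)
        (by omega) (by omega) (by omega)
    rw [← one_mul (1 : K), ← MvPolynomial.monomial_mul, pow_succ', mul_assoc]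
    exact Ideal.mul_mem_mul ⟨⟨monomial_mem_ptIdeal_pow_s12 hta, monomial_mem_ptIdeal_pow_s12 htb⟩,
      monomial_mem_ptIdeal_pow_s12 htc⟩ (ih hua hub huc)

/-- For the three coordinate points of `P^N`, `J = I(P_0) ∩ I(P_1) ∩ I(P_2)` and
`J₂ = I(P_0)² ∩ I(P_1)² ∩ I(P_2)²`, for all `q` and `r < 2`:
`I((2q+r)(P_0+P_1+P_2)) = J₂^q · J^r`. -/
theorem three_simple_points_symbolic_splitting
    (K : Type*) [Field K] (N : ℕ) (hN : 2 ≤ N) (q r : ℕ) (hr : r < 2) :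
    ptIdeal K N 0 ^ (2 * q + r) ⊓ ptIdeal K N 1 ^ (2 * q + r) ⊓ ptIdeal K N 2 ^ (2 * q + r) =
      (ptIdeal K N 0 ^ 2 ⊓ ptIdeal K N 1 ^ 2 ⊓ ptIdeal K N 2 ^ 2) ^ q *
        (ptIdeal K N 0 ⊓ ptIdeal K N 1 ⊓ ptIdeal K N 2) ^ r := by
  obtain ⟨M, rfl⟩ := Nat.exists_eq_add_of_le' hN
  apply le_antisymm
  · rintro f ⟨⟨h0, h1⟩, h2⟩
    rw [f.as_sum]
    refine Ideal.sum_mem _ fun s hs => ?_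
    rw [← mul_one (f.coeff s), ← MvPolynomial.C_mul_monomial]
    refine Ideal.mul_mem_left _ _ (monomial_mem_inf_ptIdeal_pow_mul ?_ ?_ ?_ hr
      (add_apply_le_degree_of_mem_ptIdeal_pow h0 s hs)
      (add_apply_le_degree_of_mem_ptIdeal_pow h1 s hs)
      (add_apply_le_degree_of_mem_ptIdeal_pow h2 s hs)) <;>
    simp [Fin.ext_iff, Nat.mod_eq_of_lt]
  · simp only [pow_add, pow_mul]
    exact le_inf (le_inf
      (Ideal.mul_mono (Ideal.pow_right_mono (inf_le_left.trans inf_le_left) q)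
        (Ideal.pow_right_mono (inf_le_left.trans inf_le_left) r))
      (Ideal.mul_mono (Ideal.pow_right_mono (inf_le_left.trans inf_le_right) q)
        (Ideal.pow_right_mono (inf_le_left.trans inf_le_right) r)))
      (Ideal.mul_mono (Ideal.pow_right_mono inf_le_right q)
        (Ideal.pow_right_mono inf_le_right r))
end
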